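/- arXiv:2211.09482 — 2 statements merged into one kernel-verified Lean document; each statement's English description precedes it below -/
import Mathlib

section
/- Let X be a d-dimensional λ-local spectral expander and let 0 < η, ε < 1. For any set of k-faces A ⊆ X(k) with 0 ≤ k ≤ d−1, if A is (η,ε)-non-local then ‖δ₁(A)‖ ≥ (1 − C(k+2,k)·(λ + η + 2ε))·‖A‖, where C(k+2,k) is the binomial coefficient. -/
/- Common framework: weighted simplicial complexes, links, localizations,
   local spectral expansion, cochains, coboundaries, minimality, etc. -/

open Finset

open scoped Classical

namespace HDX

variable {V : Type*} [Fintype V] [DecidableEq V]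

/-- The faces of cardinality `m` of a family of finite sets.  (A `k`-dimensional face
has cardinality `k+1`; the `(-1)`-face is the empty set, of cardinality `0`.) -/
def facesCard (Y : Finset (Finset V)) (m : ℕ) : Finset (Finset V) :=
  Y.filter fun s => s.card = m

/-- A simplicial complex: a downwards-closed family of finite sets. -/
def IsComplex (Y : Finset (Finset V)) : Prop :=
  ∀ σ ∈ Y, ∀ τ ⊆ σ, τ ∈ Y

/-- A (pure) `d`-dimensional complex: nonempty, all faces have at most `d+1` vertices, and
every face is contained in a face with exactly `d+1` vertices (a top face). -/
def IsPureDim (Y : Finset (Finset V)) (d : ℕ) : Prop :=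
  Y.Nonempty ∧ (∀ σ ∈ Y, σ.card ≤ d + 1) ∧ ∀ σ ∈ Y, ∃ τ ∈ Y, σ ⊆ τ ∧ τ.card = d + 1

/-- The weight `‖A‖` of a family `A` of faces of cardinality `m`, in a complex whose top
faces have cardinality `t`: pick a top face uniformly at random, then a uniformly random
subset of cardinality `m` of it, and take the probability that it lies in `A`. -/
noncomputable def wt (Y : Finset (Finset V)) (t m : ℕ) (A : Finset (Finset V)) : ℝ :=
  (∑ σ ∈ facesCard Y t, (((σ.powersetCard m).filter (· ∈ A)).card : ℝ)) /
    (((facesCard Y t).card : ℝ) * (t.choose m : ℝ))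

/-- The mutual weight `‖(A,B)‖` of `A` (faces of cardinality `m`) and `B` (faces of
cardinality `l`, `l ≤ m`): the probability that a random `m`-subset of a random top face is
in `A` and a further uniformly random `l`-subset of it is in `B`. -/
noncomputable def mwt (Y : Finset (Finset V)) (t m l : ℕ) (A B : Finset (Finset V)) : ℝ :=
  (∑ σ ∈ facesCard Y t, ∑ τ ∈ (σ.powersetCard m).filter (· ∈ A),
      (((τ.powersetCard l).filter (· ∈ B)).card : ℝ)) /
    (((facesCard Y t).card : ℝ) * (t.choose m : ℝ) * (m.choose l : ℝ))

/-- Localization of a family `A` to (the link of) a face `σ`: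
`A_σ = {τ \ σ | σ ⊆ τ ∈ A}`. -/
def localize (A : Finset (Finset V)) (σ : Finset V) : Finset (Finset V) :=
  (A.filter fun τ => σ ⊆ τ).image fun τ => τ \ σ

/-- The link `X_σ = {τ \ σ | σ ⊆ τ ∈ X}` of a face `σ`. -/
def link (Y : Finset (Finset V)) (σ : Finset V) : Finset (Finset V) :=
  localize Y σ

/-- `locWt Y t A m σ` is the weight `‖A_σ‖` of the localization to the link of `σ` of the
family `A` of faces of cardinality `m`, where `Y` has top faces of cardinality `t`. -/
noncomputable def locWt (Y : Finset (Finset V)) (t : ℕ) (A : Finset (Finset V)) (m : ℕ)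
    (σ : Finset V) : ℝ :=
  wt (link Y σ) (t - σ.card) (m - σ.card) (localize A σ)

/-- `w` is (the weight function of) a weighted graph which is a `λ`-spectral expander:
for every function orthogonal to the constants (in the weighted inner product) the Rayleigh
quotient of the normalized adjacency operator is at most `λ` in absolute value. -/
def IsSpectralExpanderW (w : V → V → ℝ) (lam : ℝ) : Prop :=
  ∀ f : V → ℝ, (∑ u, (∑ v, w u v) * f u) = 0 →
    |∑ u, ∑ v, w u v * f u * f v| ≤ lam * ∑ u, (∑ v, w u v) * f u ^ 2

/-- The weight of the edge `{u,v}` in the underlying weighted graph of a complex with top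
faces of cardinality `t`. -/
noncomputable def edgeWt (Y : Finset (Finset V)) (t : ℕ) (u v : V) : ℝ :=
  if u ≠ v then wt Y t 2 {({u, v} : Finset V)} else 0

/-- `λ`-local spectral expander: the underlying weighted graph of the link of every face of
dimension at most `d-2` (including the empty face) is a `λ`-spectral expander. -/
def IsLocalSpectralExpander (Y : Finset (Finset V)) (d : ℕ) (lam : ℝ) : Prop :=
  ∀ σ ∈ Y, σ.card + 2 ≤ d + 1 →
    IsSpectralExpanderW (edgeWt (link Y σ) (d + 1 - σ.card)) lam

/-- `q`-bounded degree: every vertex is contained in at most `q` top faces. -/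
def IsBoundedDegree (Y : Finset (Finset V)) (d q : ℕ) : Prop :=
  ∀ v : V, ((facesCard Y (d + 1)).filter fun σ => v ∈ σ).card ≤ q

/-- The skeleton consisting of the faces with at most `m` vertices
(i.e. of dimension at most `m - 1`). -/
def skeleton (Y : Finset (Finset V)) (m : ℕ) : Finset (Finset V) :=
  Y.filter fun σ => σ.card ≤ m

/-- `δ₁(A)`: the faces of cardinality `m+1` that contain exactly one member of `A`
(a family of faces of cardinality `m`). -/
def delta1 (Y : Finset (Finset V)) (m : ℕ) (A : Finset (Finset V)) : Finset (Finset V) :=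
  (facesCard Y (m + 1)).filter fun τ => ((τ.powersetCard m).filter (· ∈ A)).card = 1

/-- For `A ⊆ X(k)`, the set `S_{k-1}` of `(k-1)`-faces `σ` with `‖A_σ‖ ≤ η`. -/
noncomputable def nonlocalS (Y : Finset (Finset V)) (t k : ℕ) (A : Finset (Finset V))
    (η : ℝ) : Finset (Finset V) :=
  (facesCard Y k).filter fun σ => locWt Y t A (k + 1) σ ≤ η

/-- `A ⊆ X(k)` is `(η,ε)`-non-local if `‖(A, S_{k-1})‖ ≥ (1-ε)‖A‖`. -/
def IsNonlocal (Y : Finset (Finset V)) (t k : ℕ) (A : Finset (Finset V)) (η ε : ℝ) : Prop :=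
  mwt Y t (k + 1) k A (nonlocalS Y t k A η) ≥ (1 - ε) * wt Y t (k + 1) A

/-- For `A ⊆ X(k)`, the set `S_{k-2}` of `(k-2)`-faces `σ` with `‖A_σ‖ ≤ η`. -/
noncomputable def weakS (Y : Finset (Finset V)) (t k : ℕ) (A : Finset (Finset V))
    (η : ℝ) : Finset (Finset V) :=
  (facesCard Y (k - 1)).filter fun σ => locWt Y t A (k + 1) σ ≤ η

/-- `A ⊆ X(k)` is `(η,ε,α)`-weakly-non-local if `‖S_{k-2}‖ ≥ 1 - ε‖A‖` and `‖A_τ‖ ≤ 1-α`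
for every `(k-1)`-face `τ`. -/
def IsWeaklyNonlocal (Y : Finset (Finset V)) (t k : ℕ) (A : Finset (Finset V))
    (η ε α : ℝ) : Prop :=
  wt Y t (k - 1) (weakS Y t k A η) ≥ 1 - ε * wt Y t (k + 1) A ∧
    ∀ τ ∈ facesCard Y k, locWt Y t A (k + 1) τ ≤ 1 - α

section Abelian

variable {G : Type*} [AddCommGroup G]

/-- An ordered face of the complex: an injective tuple whose image is a face. -/
def IsFaceTup (Y : Finset (Finset V)) {m : ℕ} (tup : Fin m → V) : Prop :=
  Function.Injective tup ∧ Finset.image tup Finset.univ ∈ Y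

/-- A cochain over an abelian group `G` on the faces with `m` vertices (i.e. an
`(m-1)`-dimensional cochain): an antisymmetric `G`-valued function on ordered faces,
vanishing on tuples which are not ordered faces. -/
def IsCochain (Y : Finset (Finset V)) {m : ℕ} (f : (Fin m → V) → G) : Prop :=
  (∀ (tup : Fin m → V) (π : Equiv.Perm (Fin m)),
      f (tup ∘ π) = ((Equiv.Perm.sign π : ℤˣ) : ℤ) • f tup) ∧
    ∀ tup : Fin m → V, ¬IsFaceTup Y tup → f tup = 0

/-- The coboundary operator `δ(f)(v_0,…,v_m) = ∑ i, (-1)^i f(v_0,…,v_{i-1},v_{i+1},…,v_m)`. -/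
def cob {m : ℕ} (f : (Fin m → V) → G) : (Fin (m + 1) → V) → G := fun tup =>
  ∑ i : Fin (m + 1), ((-1 : ℤ) ^ (i : ℕ)) • f (tup ∘ i.succAbove)

/-- The support of `f`: the faces (with `m` vertices) on which `f` does not vanish. -/
noncomputable def suppC (Y : Finset (Finset V)) {m : ℕ} (f : (Fin m → V) → G) :
    Finset (Finset V) :=
  (facesCard Y m).filter fun σ =>
    ∃ tup : Fin m → V, Finset.image tup Finset.univ = σ ∧ f tup ≠ 0

/-- The norm `‖f‖` of a cochain: the weight of its support. -/
noncomputable def normC (Y : Finset (Finset V)) (t : ℕ) {m : ℕ} (f : (Fin m → V) → G) : ℝ :=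
  wt Y t m (suppC Y f)

/-- A cocycle: a cochain whose coboundary vanishes on all (ordered) faces. -/
def IsCocycle (Y : Finset (Finset V)) {m : ℕ} (f : (Fin m → V) → G) : Prop :=
  IsCochain Y f ∧ ∀ tup : Fin (m + 1) → V, IsFaceTup Y tup → cob f tup = 0

/-- A coboundary: a function agreeing on all ordered faces with the coboundary of a cochain
of one dimension below. -/
def IsCoboundaryFn (Y : Finset (Finset V)) {m : ℕ} (f : (Fin (m + 1) → V) → G) : Prop :=
  ∃ g : (Fin m → V) → G, IsCochain Y g ∧
    ∀ tup : Fin (m + 1) → V, IsFaceTup Y tup → f tup = cob g tup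

/-- The distance of `f` from the coboundaries. -/
noncomputable def distB (Y : Finset (Finset V)) (t : ℕ) {m : ℕ}
    (f : (Fin (m + 1) → V) → G) : ℝ :=
  sInf {r : ℝ | ∃ g : (Fin m → V) → G, IsCochain Y g ∧
    r = normC Y t fun tup => f tup - cob g tup}

/-- The distance of `f` from the cocycles. -/
noncomputable def distZ (Y : Finset (Finset V)) (t : ℕ) {m : ℕ}
    (f : (Fin m → V) → G) : ℝ :=
  sInf {r : ℝ | ∃ g : (Fin m → V) → G, IsCocycle Y g ∧
    r = normC Y t fun tup => f tup - g tup}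

/-- A minimal cochain: its weight cannot be decreased by adding a coboundary. -/
def IsMinimal (Y : Finset (Finset V)) (t : ℕ) {m : ℕ} (f : (Fin (m + 1) → V) → G) : Prop :=
  ∀ g : (Fin m → V) → G, IsCochain Y g →
    normC Y t f ≤ normC Y t fun tup => f tup - cob g tup

/-- The localization `f_v` of a cochain to the link of a vertex `v`: `f_v(τ) = f(vτ)`. -/
def localizeC {m : ℕ} (f : (Fin (m + 1) → V) → G) (v : V) : (Fin m → V) → G :=
  fun tup => f (Fin.cons v tup)

/-- A locally minimal cochain: all its localizations to links of vertices are minimal. -/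
def IsLocallyMinimal (Y : Finset (Finset V)) (t : ℕ) {m : ℕ}
    (f : (Fin (m + 2) → V) → G) : Prop :=
  ∀ v : V, ({v} : Finset V) ∈ Y → IsMinimal (link Y {v}) (t - 1) (localizeC f v)

/-- A `β`-coboundary expander over `G` (for a complex with top faces of cardinality `t`):
for every dimension below the dimension of the complex, every cochain which is not a
coboundary satisfies `‖δ(f)‖ ≥ β · dist(f, B)`. -/
def IsCoboundaryExpander (Y : Finset (Finset V)) (t : ℕ) (G : Type*) [AddCommGroup G]
    (β : ℝ) : Prop :=
  ∀ m : ℕ, m + 2 ≤ t → ∀ f : (Fin (m + 1) → V) → G, IsCochain Y f → ¬IsCoboundaryFn Y f →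
    normC Y t (cob f) ≥ β * distB Y t f

/-- The links (of all nonempty faces) of `Y` are `β`-coboundary expanders over `G`. -/
def HasCobExpandingLinks (Y : Finset (Finset V)) (d : ℕ) (G : Type*) [AddCommGroup G]
    (β : ℝ) : Prop :=
  ∀ σ ∈ Y, σ.Nonempty → IsCoboundaryExpander (link Y σ) (d + 1 - σ.card) G β

/-- For a family `A` of faces with `c` vertices (i.e. `A ⊆ X(k)` with `c = k+1`),
`Sbar Y t c A η r` is the set `S̄_{k-1-r}` of "fat" faces of cardinality `c-1-r`:
`S̄_{k-1} = {σ ∈ X(k-1) : ‖A_σ‖ > η}` and, going down,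
`S̄_i = {σ ∈ X(i) : ‖(S̄_{i+1})_σ‖ > η^{2^{k-i-1}}}`. -/
noncomputable def Sbar (Y : Finset (Finset V)) (t c : ℕ) (A : Finset (Finset V)) (η : ℝ) :
    ℕ → Finset (Finset V)
  | 0 => (facesCard Y (c - 1)).filter fun σ => η < locWt Y t A c σ
  | r + 1 =>
      (facesCard Y (c - 1 - (r + 1))).filter fun σ =>
        η ^ 2 ^ (r + 1) < locWt Y t (Sbar Y t c A η r) (c - 1 - r) σ

/-- `Υ`: the set of `(k+1)`-faces (cardinality `c+1`, where `c = k+1`) containing two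
`i`-faces `σ, σ' ∈ S̄_i` (for some `i ≥ 0`) with `σ ∪ σ' ∈ X(i+1)` and `σ ∩ σ' ∈ S_{i-1}`. -/
noncomputable def Upsilon (Y : Finset (Finset V)) (t c : ℕ) (A : Finset (Finset V))
    (η : ℝ) : Finset (Finset V) :=
  (facesCard Y (c + 1)).filter fun τ => ∃ r : ℕ, r + 2 ≤ c ∧
    ∃ σ ∈ Sbar Y t c A η r, ∃ σ' ∈ Sbar Y t c A η r, σ ⊆ τ ∧ σ' ⊆ τ ∧
      σ ∪ σ' ∈ facesCard Y (c - r) ∧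
      σ ∩ σ' ∈ facesCard Y (c - 2 - r) \ Sbar Y t c A η (r + 1)

/-- `f↓σ` (for `σ` of cardinality `c-1-r`, i.e. an `(k-r)`-dimensional... face): the members
`τ` of `A` admitting a chain of containments `τ ⊃ τ_{k-1} ⊃ ⋯ ⊃ τ_{i+1} ⊃ σ` with each
`τ_j ∈ S̄_j`. -/
noncomputable def fdown (Y : Finset (Finset V)) (t c : ℕ) (A : Finset (Finset V)) (η : ℝ) :
    ℕ → Finset V → Finset (Finset V)
  | 0, σ => A.filter fun τ => σ ⊆ τ
  | r + 1, σ =>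
      A.filter fun τ => ∃ τ' ∈ Sbar Y t c A η r, σ ⊆ τ' ∧ τ' ≠ σ ∧ τ ∈ fdown Y t c A η r τ'

end Abelian

section NonAbelian

variable {G : Type*} [Group G]

/-- A 0-cochain over a (possibly non-abelian) group: vanishes on non-vertices. -/
def IsC0 (Y : Finset (Finset V)) (f : V → G) : Prop :=
  ∀ v : V, ({v} : Finset V) ∉ Y → f v = 1

/-- A 1-cochain over a (possibly non-abelian) group: antisymmetric, supported on edges. -/
def IsC1 (Y : Finset (Finset V)) (g : V → V → G) : Prop :=
  (∀ u v : V, g v u = (g u v)⁻¹) ∧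
    ∀ u v : V, ({u, v} : Finset V) ∉ Y ∨ u = v → g u v = 1

/-- A 2-cochain over a (possibly non-abelian) group: antisymmetric, supported on triangles. -/
def IsC2 (Y : Finset (Finset V)) (f : V → V → V → G) : Prop :=
  (∀ u v w : V, f u v w = f v w u) ∧ (∀ u v w : V, f v u w = (f u v w)⁻¹) ∧
    ∀ u v w : V, ({u, v, w} : Finset V) ∉ Y ∨ u = v ∨ u = w ∨ v = w → f u v w = 1

/-- The coboundary of a 0-cochain: `δ(f)(u,v) = f(u)·f(v)⁻¹`. -/
def d0 (f : V → G) : V → V → G := fun u v => f u * (f v)⁻¹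

/-- The coboundary of a 1-cochain: `δ(g)(u,v,w) = g(u,v)·g(v,w)·g(w,u)`. -/
def d1 (g : V → V → G) : V → V → V → G := fun u v w => g u v * g v w * g w u

/-- The support (a set of vertices, as singleton faces) of a `G`-valued function. -/
noncomputable def supp0 (Y : Finset (Finset V)) (f : V → G) : Finset (Finset V) :=
  (facesCard Y 1).filter fun s => ∃ v : V, ({v} : Finset V) = s ∧ f v ≠ 1

/-- The support (a set of edges) of a `G`-valued function on ordered edges. -/
noncomputable def supp1 (Y : Finset (Finset V)) (g : V → V → G) : Finset (Finset V) :=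
  (facesCard Y 2).filter fun e => ∃ u v : V, ({u, v} : Finset V) = e ∧ u ≠ v ∧ g u v ≠ 1

/-- The support (a set of triangles) of a `G`-valued function on ordered triangles. -/
noncomputable def supp2 (Y : Finset (Finset V)) (f : V → V → V → G) : Finset (Finset V) :=
  (facesCard Y 3).filter fun s =>
    ∃ u v w : V, ({u, v, w} : Finset V) = s ∧ u ≠ v ∧ u ≠ w ∧ v ≠ w ∧ f u v w ≠ 1

/-- The action of 0-cochains on 1-cochains: `h.g(u,v) = h(u)·g(u,v)·h(v)⁻¹`. -/
def act (h : V → G) (g : V → V → G) : V → V → G := fun u v => h u * g u v * (h v)⁻¹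

/-- The norm of a 1-cochain: the weight of its support. -/
noncomputable def norm1 (Y : Finset (Finset V)) (t : ℕ) (g : V → V → G) : ℝ :=
  wt Y t 2 (supp1 Y g)

/-- The norm of a 2-cochain: the weight of its support. -/
noncomputable def norm2 (Y : Finset (Finset V)) (t : ℕ) (f : V → V → V → G) : ℝ :=
  wt Y t 3 (supp2 Y f)

/-- The distance between two 1-cochains: `dist(g,g') = ‖g'g⁻¹‖`. -/
noncomputable def dist1 (Y : Finset (Finset V)) (t : ℕ) (g g' : V → V → G) : ℝ :=
  norm1 Y t fun u v => g' u v * (g u v)⁻¹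

/-- A minimal 1-cochain: its weight cannot be decreased by acting with a 0-cochain. -/
def Minimal1 (Y : Finset (Finset V)) (t : ℕ) (g : V → V → G) : Prop :=
  ∀ h : V → G, IsC0 Y h → norm1 Y t g ≤ norm1 Y t (act h g)

/-- The localization `f_v` of a 2-cochain to the link of `v`: `f_v(u,w) = f(v,u,w)`. -/
def locC1 (f : V → V → V → G) (v : V) : V → V → G := fun u w => f v u w

/-- A locally minimal 2-cochain: all its localizations to links of vertices are minimal. -/
def LocallyMinimal2 (Y : Finset (Finset V)) (t : ℕ) (f : V → V → V → G) : Prop :=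
  ∀ v : V, ({v} : Finset V) ∈ Y → Minimal1 (link Y {v}) (t - 1) (locC1 f v)

/-- A 1-coboundary: `g = δ(h)` on the edges, for some 0-cochain `h`. -/
def IsCoboundary1 (Y : Finset (Finset V)) (g : V → V → G) : Prop :=
  ∃ h : V → G, IsC0 Y h ∧
    ∀ u v : V, ({u, v} : Finset V) ∈ Y → u ≠ v → g u v = h u * (h v)⁻¹

/-- A 1-cocycle: a 1-cochain whose coboundary is trivial on all triangles. -/
def IsCocycle1 (Y : Finset (Finset V)) (g : V → V → G) : Prop :=
  IsC1 Y g ∧ ∀ u v w : V, ({u, v, w} : Finset V) ∈ Y → u ≠ v → u ≠ w → v ≠ w →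
    d1 g u v w = 1

/-- A constant 0-cochain (member of `B⁰`). -/
def IsConst0 (Y : Finset (Finset V)) (f : V → G) : Prop :=
  ∃ c : G, ∀ v : V, ({v} : Finset V) ∈ Y → f v = c

/-- The distance of a 0-cochain from `B⁰` (the constants). -/
noncomputable def distB0 (Y : Finset (Finset V)) (t : ℕ) (f : V → G) : ℝ :=
  sInf {r : ℝ | ∃ c : G, r = wt Y t 1 (supp0 Y fun v => f v * c⁻¹)}

/-- The distance of a 1-cochain from the 1-coboundaries. -/
noncomputable def distB1 (Y : Finset (Finset V)) (t : ℕ) (g : V → V → G) : ℝ :=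
  sInf {r : ℝ | ∃ h : V → G, IsC0 Y h ∧ r = dist1 Y t g (act h g)}

/-- The distance of a 1-cochain from the 1-cocycles. -/
noncomputable def distZ1 (Y : Finset (Finset V)) (t : ℕ) (g : V → V → G) : ℝ :=
  sInf {r : ℝ | ∃ g' : V → V → G, IsCocycle1 Y g' ∧ r = dist1 Y t g g'}

/-- A `β`-coboundary expander over a (possibly non-abelian) group `G`, for a complex with top
faces of cardinality `t`: in every dimension (0 and 1) below the dimension of the complex,
every cochain which is not a coboundary satisfies `‖δ(f)‖ ≥ β·dist(f,B)`. -/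
def CobExpanderNA (Y : Finset (Finset V)) (t : ℕ) (G : Type*) [Group G] (β : ℝ) : Prop :=
  (2 ≤ t → ∀ f : V → G, IsC0 Y f → ¬IsConst0 Y f →
      norm1 Y t (d0 f) ≥ β * distB0 Y t f) ∧
    (3 ≤ t → ∀ g : V → V → G, IsC1 Y g → ¬IsCoboundary1 Y g →
      norm2 Y t (d1 g) ≥ β * distB1 Y t g)

/-- The links (of all nonempty faces) of `Y` are `β`-coboundary expanders over `G`. -/
def HasCobExpandingLinksNA (Y : Finset (Finset V)) (d : ℕ) (G : Type*) [Group G]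
    (β : ℝ) : Prop :=
  ∀ σ ∈ Y, σ.Nonempty → CobExpanderNA (link Y σ) (d + 1 - σ.card) G β

end NonAbelian

end HDX

namespace HDX
set_option linter.unusedSectionVars false

variable {V : Type*} [Fintype V] [DecidableEq V]

/-- number of top faces containing `s` -/
noncomputable def dg (Y : Finset (Finset V)) (t : ℕ) (s : Finset V) : ℝ :=
  (((facesCard Y t).filter fun ρ => s ⊆ ρ).card : ℝ)

lemma dg_nonneg (Y : Finset (Finset V)) (t : ℕ) (s : Finset V) : 0 ≤ dg Y t s := by
  unfold dg; positivity

lemma dg_eq_sum (Y : Finset (Finset V)) (t : ℕ) (s : Finset V) :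
    dg Y t s = ∑ ρ ∈ facesCard Y t, if s ⊆ ρ then (1:ℝ) else 0 := by
  unfold dg; rw [Finset.sum_boole]

lemma double_count (Y : Finset (Finset V)) (t m : ℕ) (B : Finset (Finset V))
    (g : Finset V → ℝ) :
    ∑ ρ ∈ facesCard Y t, ∑ s ∈ (ρ.powersetCard m).filter (· ∈ B), g s =
      ∑ s ∈ B.filter (fun s => s.card = m), dg Y t s * g s := by
  have h1 : ∀ ρ ∈ facesCard Y t, ∑ s ∈ (ρ.powersetCard m).filter (· ∈ B), g s =
      ∑ s ∈ B.filter (fun s => s.card = m), if s ⊆ ρ then g s else 0 := by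
    intro ρ _
    rw [← Finset.sum_filter]
    apply Finset.sum_congr _ (fun _ _ => rfl)
    ext s
    simp only [Finset.mem_filter, Finset.mem_powersetCard]
    tauto
  rw [Finset.sum_congr rfl h1, Finset.sum_comm]
  apply Finset.sum_congr rfl
  intro s _
  rw [dg_eq_sum, Finset.sum_mul]
  apply Finset.sum_congr rfl
  intro ρ _
  split_ifs <;> simp

lemma wt_eq (Y : Finset (Finset V)) (t m : ℕ) (B : Finset (Finset V)) :
    wt Y t m B = (∑ s ∈ B.filter (fun s => s.card = m), dg Y t s) /
      (((facesCard Y t).card : ℝ) * (t.choose m : ℝ)) := by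
  unfold wt
  congr 1
  have := double_count Y t m B (fun _ => 1)
  simpa using this

lemma mwt_eq (Y : Finset (Finset V)) (t m l : ℕ) (A B : Finset (Finset V)) :
    mwt Y t m l A B = (∑ τ ∈ A.filter (fun s => s.card = m), dg Y t τ *
      (((τ.powersetCard l).filter (· ∈ B)).card : ℝ)) /
      (((facesCard Y t).card : ℝ) * (t.choose m : ℝ) * (m.choose l : ℝ)) := by
  unfold mwt
  rw [double_count]

/-- summing the degrees of extensions -/
lemma sum_dg_insert (Y : Finset (Finset V)) (t : ℕ) (s : Finset V) :
    ∑ v ∈ univ \ s, dg Y t (insert v s) = ((t : ℝ) - s.card) * dg Y t s := by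
  simp_rw [dg_eq_sum]
  rw [Finset.sum_comm, Finset.mul_sum]
  apply Finset.sum_congr rfl
  intro ρ hρ
  have hc : ρ.card = t := (Finset.mem_filter.mp hρ).2
  by_cases hs : s ⊆ ρ
  · simp only [Finset.insert_subset_iff, hs, and_true, if_true, mul_one]
    rw [Finset.sum_boole]
    have : (univ \ s).filter (fun v => v ∈ ρ) = ρ \ s := by
      ext v; simp [and_comm]
    rw [this, Finset.card_sdiff_of_subset hs, Nat.cast_sub (Finset.card_le_card hs), hc]
  · simp [Finset.insert_subset_iff, hs]

/-- flags of codimension one -/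
lemma flag_sum (k : ℕ) (h : Finset V → Finset V → ℝ) :
    ∑ τ ∈ powersetCard (k + 1) (univ : Finset V), ∑ σ ∈ powersetCard k τ, h σ τ =
      ∑ σ ∈ powersetCard k (univ : Finset V), ∑ u ∈ univ \ σ, h σ (insert u σ) := by
  rw [Finset.sum_sigma', Finset.sum_sigma']
  symm
  apply Finset.sum_bij (fun (x : Σ _ : Finset V, V) _ => (⟨insert x.2 x.1, x.1⟩ : Σ _ : Finset V, Finset V))
  · rintro ⟨σ, u⟩ hx
    simp only [Finset.mem_sigma, Finset.mem_powersetCard, Finset.mem_sdiff] at hx ⊢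
    refine ⟨⟨Finset.subset_univ _, ?_⟩, Finset.subset_insert _ _, hx.1.2⟩
    rw [Finset.card_insert_of_notMem hx.2.2, hx.1.2]
  · rintro ⟨σ, u⟩ hx ⟨σ', u'⟩ hx' he
    simp only [Finset.mem_sigma, Finset.mem_powersetCard, Finset.mem_sdiff] at hx hx'
    simp only [Sigma.mk.injEq, heq_eq_eq] at he
    obtain ⟨h1, h2⟩ := he
    subst h2
    have : u ∈ insert u' σ := h1 ▸ Finset.mem_insert_self _ _
    rcases Finset.mem_insert.mp this with h | h
    · rw [h]
    · exact absurd h hx.2.2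
  · rintro ⟨τ, σ⟩ hx
    simp only [Finset.mem_sigma, Finset.mem_powersetCard] at hx
    obtain ⟨⟨_, hτ⟩, hs, hσ⟩ := hx
    obtain ⟨u, hu⟩ : ∃ u, τ \ σ = {u} := by
      rw [← Finset.card_eq_one, Finset.card_sdiff_of_subset hs]; omega
    have hmem : u ∈ τ \ σ := by rw [hu]; simp
    refine ⟨⟨σ, u⟩, ?_, ?_⟩
    · simp only [Finset.mem_sigma, Finset.mem_powersetCard, Finset.mem_sdiff]
      exact ⟨⟨Finset.subset_univ _, hσ⟩, Finset.mem_univ _, (Finset.mem_sdiff.mp hmem).2⟩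
    · have : insert u σ = τ := by
        rw [Finset.insert_eq, ← hu, Finset.sdiff_union_of_subset hs]
      simp [this]
  · rintro ⟨σ, u⟩ hx
    rfl

/-- expander mixing -/
lemma mixing (w : V → V → ℝ) (lam η : ℝ) (hw : IsSpectralExpanderW w lam)
    (hsymm : ∀ u v, w u v = w v u) (f : V → ℝ) (hf : ∀ u, f u ^ 2 = f u)
    (hW : 0 < ∑ u, ∑ v, w u v) (hM0 : 0 ≤ ∑ u, (∑ v, w u v) * f u)
    (hη1 : η < 1) (hM : ∑ u, (∑ v, w u v) * f u ≤ η * ∑ u, ∑ v, w u v) :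
    (∑ u, ∑ v, w u v * f u * f v ≤ (lam + η) * ∑ u, (∑ v, w u v) * f u) ∧
      ((∑ u, (∑ v, w u v) * f u = 0) ∨ 0 ≤ lam) := by
  set W := ∑ u, ∑ v, w u v with hWd
  set M := ∑ u, (∑ v, w u v) * f u with hMd
  set E := ∑ u, ∑ v, w u v * f u * f v with hE
  set p := M / W with hp
  have hpW : p * W = M := by rw [hp]; field_simp
  have hp0 : 0 ≤ p := by positivity
  have hpη : p ≤ η := by rw [hp, div_le_iff₀ hW]; exact hM
  have hM' : ∑ u, ∑ v, w u v * f u = M := by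
    rw [hMd]; simp_rw [Finset.sum_mul]
  have hM'' : ∑ u, ∑ v, w u v * f v = M := by
    rw [Finset.sum_comm, ← hM']
    refine Finset.sum_congr rfl fun u _ => Finset.sum_congr rfl fun v _ => by rw [hsymm]
  have h1 : ∑ u, (∑ v, w u v) * (f u - p) = 0 := by
    simp_rw [mul_sub, Finset.sum_sub_distrib, ← Finset.sum_mul]
    rw [← hWd, ← hMd]; linarith
  have h2 : ∑ u, ∑ v, w u v * (f u - p) * (f v - p) = E - p * M := by
    have : ∀ u v, w u v * (f u - p) * (f v - p) =
        w u v * f u * f v - p * (w u v * f u) - p * (w u v * f v) + p ^ 2 * w u v := by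
      intro u v; ring
    simp_rw [this, Finset.sum_add_distrib, Finset.sum_sub_distrib, ← Finset.mul_sum]
    rw [← hE, hM', hM'', ← hWd]
    linear_combination p * hpW
  have h3 : ∑ u, (∑ v, w u v) * (f u - p) ^ 2 = M - p * M := by
    have : ∀ u, (∑ v, w u v) * (f u - p) ^ 2 =
        (∑ v, w u v) * f u - 2 * p * ((∑ v, w u v) * f u) + p ^ 2 * (∑ v, w u v) := by
      intro u; linear_combination (∑ v, w u v) * hf u
    simp_rw [this, Finset.sum_add_distrib, Finset.sum_sub_distrib, ← Finset.mul_sum]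
    rw [← hMd, ← hWd]
    linear_combination p * hpW
  have h4 := hw (fun u => f u - p) h1
  simp only [h2, h3] at h4
  have h5 : 0 ≤ lam * (M - p * M) := le_trans (abs_nonneg _) h4
  have h6 := le_trans (le_abs_self _) h4
  rcases hM0.eq_or_lt with h0 | h0
  · refine ⟨?_, Or.inl h0.symm⟩
    rw [← h0] at h6 ⊢; linarith
  · have hl : 0 ≤ lam := by
      have : 0 < M - p * M := by nlinarith
      by_contra hneg
      push Not at hneg
      nlinarith
    refine ⟨?_, Or.inr hl⟩
    nlinarith [mul_nonneg hl (mul_nonneg hp0 hM0), mul_nonneg (sub_nonneg.mpr hpη) hM0]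

lemma scale_expander (w : V → V → ℝ) (lam c : ℝ) (hc : 0 < c)
    (h : IsSpectralExpanderW (fun u v => c * w u v) lam) : IsSpectralExpanderW w lam := by
  intro f hf
  have h1 := h f (by
    simp_rw [← Finset.mul_sum, mul_assoc]
    rw [← Finset.mul_sum, hf, mul_zero])
  simp_rw [mul_assoc, ← Finset.mul_sum] at h1
  rw [abs_mul, abs_of_pos hc] at h1
  simp_rw [mul_assoc, ← Finset.mul_sum] at h1
  simp_rw [mul_assoc]
  have h2 : c * |∑ u, ∑ v, w u v * (f u * f v)| ≤
      c * (lam * ∑ u, (∑ v, w u v) * f u ^ 2) := by linarith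
  exact le_of_mul_le_mul_left h2 hc

lemma facesCard_link (X : Finset (Finset V)) (t : ℕ) (σ : Finset V) (hσ : σ.card ≤ t) :
    facesCard (link X σ) (t - σ.card) =
      ((facesCard X t).filter fun ρ => σ ⊆ ρ).image fun ρ => ρ \ σ := by
  ext s
  simp only [facesCard, link, localize, Finset.mem_filter, Finset.mem_image]
  constructor
  · rintro ⟨⟨ρ, ⟨h1, h2⟩, rfl⟩, h3⟩
    refine ⟨ρ, ⟨⟨h1, ?_⟩, h2⟩, rfl⟩
    rw [Finset.card_sdiff_of_subset h2] at h3
    have := Finset.card_le_card h2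
    omega
  · rintro ⟨ρ, ⟨⟨h1, h3⟩, h2⟩, rfl⟩
    refine ⟨⟨ρ, ⟨h1, h2⟩, rfl⟩, ?_⟩
    rw [Finset.card_sdiff_of_subset h2, h3]

lemma sdiff_injOn (S : Finset (Finset V)) (σ : Finset V) (h : ∀ ρ ∈ S, σ ⊆ ρ) :
    Set.InjOn (fun ρ : Finset V => ρ \ σ) (S : Set (Finset V)) := by
  intro a ha b hb hab
  have h1 := Finset.sdiff_union_of_subset (h a ha)
  have h2 := Finset.sdiff_union_of_subset (h b hb)
  simp only at hab
  rw [← h1, ← h2, hab]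

lemma card_facesCard_link (X : Finset (Finset V)) (t : ℕ) (σ : Finset V) (hσ : σ.card ≤ t) :
    ((facesCard (link X σ) (t - σ.card)).card : ℝ) = dg X t σ := by
  rw [facesCard_link X t σ hσ, Finset.card_image_of_injOn]
  · rfl
  · exact sdiff_injOn _ σ (fun ρ hρ => (Finset.mem_filter.mp hρ).2)

lemma dg_link (X : Finset (Finset V)) (t : ℕ) (σ s : Finset V) (hσ : σ.card ≤ t)
    (hd : Disjoint σ s) :
    dg (link X σ) (t - σ.card) s = dg X t (σ ∪ s) := by
  unfold dg
  rw [facesCard_link X t σ hσ, Finset.filter_image, Finset.card_image_of_injOn]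
  · congr 2
    ext ρ
    simp only [Finset.mem_filter, Finset.union_subset_iff, Finset.subset_sdiff]
    have := hd.symm
    tauto
  · exact sdiff_injOn _ σ (fun ρ hρ => (Finset.mem_filter.mp (Finset.mem_filter.mp hρ).1).2)

lemma dg_link_zero (X : Finset (Finset V)) (t : ℕ) (σ s : Finset V) (hσ : σ.card ≤ t)
    (hd : ¬ Disjoint σ s) :
    dg (link X σ) (t - σ.card) s = 0 := by
  unfold dg
  rw [facesCard_link X t σ hσ, Finset.filter_image]
  simp only [Nat.cast_eq_zero, Finset.card_eq_zero, Finset.image_eq_empty]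
  rw [Finset.filter_eq_empty_iff]
  intro ρ _ h
  rw [Finset.subset_sdiff] at h
  exact hd h.2.symm

/-- unnormalised edge weight in the link -/
noncomputable def We (X : Finset (Finset V)) (t : ℕ) (σ : Finset V) (u v : V) : ℝ :=
  if u ≠ v ∧ u ∉ σ ∧ v ∉ σ then dg X t (insert u (insert v σ)) else 0

lemma We_nonneg (X : Finset (Finset V)) (t : ℕ) (σ : Finset V) (u v : V) :
    0 ≤ We X t σ u v := by
  unfold We; split_ifs
  · exact dg_nonneg _ _ _
  · exact le_rfl

lemma We_symm (X : Finset (Finset V)) (t : ℕ) (σ : Finset V) (u v : V) :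
    We X t σ u v = We X t σ v u := by
  unfold We
  rw [Finset.insert_comm]
  have : (u ≠ v ∧ u ∉ σ ∧ v ∉ σ) ↔ (v ≠ u ∧ v ∉ σ ∧ u ∉ σ) := by
    rw [ne_comm]; tauto
  simp only [this]

lemma edgeWt_link (X : Finset (Finset V)) (t : ℕ) (σ : Finset V) (hσ : σ.card ≤ t) (u v : V) :
    edgeWt (link X σ) (t - σ.card) u v =
      (1 / (dg X t σ * ((t - σ.card).choose 2 : ℝ))) * We X t σ u v := by
  unfold edgeWt We
  by_cases huv : u = v
  · simp [huv]
  have hf : ({({u, v} : Finset V)} : Finset (Finset V)).filter (fun s => s.card = 2) =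
      {({u, v} : Finset V)} := by
    rw [Finset.filter_eq_self]
    intro a ha
    rw [Finset.mem_singleton.mp ha, Finset.card_pair huv]
  rw [if_pos huv, wt_eq, card_facesCard_link X t σ hσ, hf, Finset.sum_singleton]
  by_cases hd : u ∉ σ ∧ v ∉ σ
  · rw [if_pos ⟨huv, hd⟩, dg_link X t σ _ hσ (by
      simp [hd.1, hd.2])]
    have : σ ∪ {u, v} = insert u (insert v σ) := by
      ext x; simp <;> tauto
    rw [this]; ring
  · rw [if_neg (by tauto), dg_link_zero X t σ _ hσ (by
      simp <;> tauto)]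
    simp

/-- unnormalised weight of the localization -/
noncomputable def Ml (X : Finset (Finset V)) (t : ℕ) (A : Finset (Finset V)) (σ : Finset V) : ℝ :=
  ∑ u ∈ univ \ σ, if insert u σ ∈ A then dg X t (insert u σ) else 0

lemma Ml_nonneg (X : Finset (Finset V)) (t : ℕ) (A : Finset (Finset V)) (σ : Finset V) :
    0 ≤ Ml X t A σ := by
  unfold Ml
  refine Finset.sum_nonneg fun u _ => ?_
  split_ifs
  · exact dg_nonneg _ _ _
  · exact le_rfl

lemma locWt_eq (X : Finset (Finset V)) (t k : ℕ) (A : Finset (Finset V)) (σ : Finset V)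
    (hσk : σ.card = k) (hσ : σ.card ≤ t) :
    locWt X t A (k + 1) σ = Ml X t A σ / (dg X t σ * ((t : ℝ) - k)) := by
  unfold locWt
  rw [wt_eq, card_facesCard_link X t σ hσ]
  have e1 : k + 1 - σ.card = 1 := by omega
  rw [e1, Nat.choose_one_right, Nat.cast_sub hσ, hσk]
  congr 1
  unfold Ml
  rw [← Finset.sum_filter]
  symm
  apply Finset.sum_bij (fun u _ => ({u} : Finset V))
  · intro u hu
    simp only [Finset.mem_filter, Finset.mem_sdiff, Finset.mem_univ, true_and] at hu
    simp only [localize, Finset.mem_filter, Finset.mem_image, Finset.card_singleton, and_true]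
    refine ⟨insert u σ, ⟨hu.2, Finset.subset_insert _ _⟩, ?_⟩
    rw [Finset.insert_sdiff_cancel hu.1]
  · intro a _ b _ hab
    exact Finset.singleton_injective hab
  · intro s hs
    simp only [localize, Finset.mem_filter, Finset.mem_image] at hs
    obtain ⟨⟨τ, ⟨h1, h2⟩, rfl⟩, h3⟩ := hs
    obtain ⟨u, hu⟩ := Finset.card_eq_one.mp h3
    have hmem : u ∈ τ \ σ := by rw [hu]; simp
    refine ⟨u, ?_, hu.symm⟩
    have : insert u σ = τ := by
      rw [Finset.insert_eq, ← hu, Finset.sdiff_union_of_subset h2]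
    simp only [Finset.mem_filter, Finset.mem_sdiff, Finset.mem_univ, true_and, this]
    exact ⟨(Finset.mem_sdiff.mp hmem).2, h1⟩
  · intro u hu
    simp only [Finset.mem_filter, Finset.mem_sdiff, Finset.mem_univ, true_and] at hu
    rw [← hσk, dg_link X t σ _ hσ (by simpa using hu.1)]
    congr 1
    ext x; simp <;> tauto

lemma We_row (X : Finset (Finset V)) (t : ℕ) (σ : Finset V) (u : V) :
    ∑ v, We X t σ u v =
      if u ∉ σ then ((t : ℝ) - σ.card - 1) * dg X t (insert u σ) else 0 := by
  by_cases hu : u ∈ σ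
  · simp [We, hu]
  · have := sum_dg_insert X t (insert u σ)
    rw [Finset.card_insert_of_notMem hu] at this
    push_cast at this
    rw [if_pos hu, sub_sub, ← this]
    unfold We
    rw [← Finset.sum_filter]
    apply Finset.sum_congr
    · ext v
      simp only [Finset.mem_filter, Finset.mem_sdiff, Finset.mem_univ, true_and,
        Finset.mem_insert, hu, not_false_eq_true, not_or, ne_eq]
      rw [eq_comm]
    · intro v _
      rw [Finset.insert_comm]

noncomputable def fA (A : Finset (Finset V)) (σ : Finset V) (u : V) : ℝ :=
  if u ∉ σ ∧ insert u σ ∈ A then 1 else 0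

noncomputable def Ql (X : Finset (Finset V)) (t : ℕ) (A : Finset (Finset V)) (σ : Finset V) : ℝ :=
  ∑ u, ∑ v, We X t σ u v * fA A σ u * fA A σ v

lemma We_fA (X : Finset (Finset V)) (t : ℕ) (A : Finset (Finset V)) (σ : Finset V) :
    ∑ u, (∑ v, We X t σ u v) * fA A σ u = ((t : ℝ) - σ.card - 1) * Ml X t A σ := by
  simp_rw [We_row]
  unfold Ml fA
  rw [Finset.mul_sum, ← Finset.sum_subset (Finset.subset_univ (univ \ σ))]
  · apply Finset.sum_congr rfl
    intro u hu
    have : u ∉ σ := by simpa using hu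
    simp [this]
  · intro u _ hu
    have : u ∈ σ := by simpa using hu
    simp [this]

lemma We_total (X : Finset (Finset V)) (t : ℕ) (σ : Finset V) :
    ∑ u, ∑ v, We X t σ u v = ((t : ℝ) - σ.card - 1) * (((t : ℝ) - σ.card) * dg X t σ) := by
  simp_rw [We_row]
  rw [← sum_dg_insert, Finset.mul_sum, ← Finset.sum_subset (Finset.subset_univ (univ \ σ))]
  · apply Finset.sum_congr rfl
    intro u hu
    have : u ∉ σ := by simpa using hu
    simp [this]
  · intro u _ hu
    have : u ∈ σ := by simpa using hu
    simp [this]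

lemma Ql_le (X : Finset (Finset V)) (t : ℕ) (A : Finset (Finset V)) (σ : Finset V) :
    Ql X t A σ ≤ ((t : ℝ) - σ.card - 1) * Ml X t A σ := by
  rw [← We_fA]
  unfold Ql
  simp_rw [Finset.sum_mul]
  refine Finset.sum_le_sum fun u _ => Finset.sum_le_sum fun v _ => ?_
  have h1 : fA A σ v ≤ 1 := by unfold fA; split_ifs <;> norm_num
  have h2 : 0 ≤ fA A σ u := by unfold fA; split_ifs <;> norm_num
  exact mul_le_of_le_one_right (mul_nonneg (We_nonneg _ _ _ _ _) h2) h1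

lemma Ql_good (X : Finset (Finset V)) (d k : ℕ) (lam η : ℝ)
    (hlse : IsLocalSpectralExpander X d lam) (hη1 : η < 1)
    (A : Finset (Finset V)) (σ : Finset V) (hσX : σ ∈ X) (hσk : σ.card = k) (hk : k + 1 ≤ d)
    (hpos : 0 < dg X (d + 1) σ) (hS : locWt X (d + 1) A (k + 1) σ ≤ η) :
    Ql X (d + 1) A σ ≤ (lam + η) * (((d + 1 : ℕ) - k - 1 : ℝ) * Ml X (d + 1) A σ) ∧
      (Ml X (d + 1) A σ = 0 ∨ 0 ≤ lam) := by
  have hle : σ.card ≤ d + 1 := by omega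
  have hE := hlse σ hσX (by omega)
  have hch : (0 : ℝ) < ((d + 1 - σ.card).choose 2 : ℝ) := by
    exact_mod_cast Nat.choose_pos (by omega)
  have hE2 : IsSpectralExpanderW (We X (d + 1) σ) lam := by
    apply scale_expander _ _ (1 / (dg X (d + 1) σ * ((d + 1 - σ.card).choose 2 : ℝ)))
    · positivity
    · have : (fun u v => (1 / (dg X (d + 1) σ * ((d + 1 - σ.card).choose 2 : ℝ))) *
          We X (d + 1) σ u v) = edgeWt (link X σ) (d + 1 - σ.card) := by
        funext u v
        rw [edgeWt_link X (d + 1) σ hle]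
      rw [this]; exact hE
  have hkd : (k : ℝ) + 1 ≤ d := by exact_mod_cast hk
  have hc1 : (0 : ℝ) < ((d + 1 : ℕ) : ℝ) - k - 1 := by push_cast; linarith
  have hc2 : (0 : ℝ) < ((d + 1 : ℕ) : ℝ) - k := by linarith
  rw [locWt_eq X (d + 1) k A σ hσk hle, div_le_iff₀ (by positivity)] at hS
  have hM := We_fA X (d + 1) A σ
  have hT := We_total X (d + 1) σ
  rw [hσk] at hM hT
  have key := mixing (We X (d + 1) σ) lam η hE2 (We_symm X (d + 1) σ) (fA A σ)
    (by intro u; unfold fA; split_ifs <;> norm_num)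
    (by rw [hT]; positivity)
    (by rw [hM]; exact mul_nonneg hc1.le (Ml_nonneg _ _ _ _))
    hη1
    (by
      rw [hM, hT]
      have := mul_le_mul_of_nonneg_left hS hc1.le
      linarith)
  rw [hM] at key
  refine ⟨key.1, ?_⟩
  rcases key.2 with h | h
  · left
    rcases mul_eq_zero.mp h with h | h
    · exact absurd h hc1.ne'
    · exact h
  · exact Or.inr h

/-- number of members of `A` in `τ` -/
noncomputable def aA (A : Finset (Finset V)) (m : ℕ) (τ : Finset V) : ℕ :=
  ((τ.powersetCard m).filter (· ∈ A)).card

lemma aA_eq (A : Finset (Finset V)) (m : ℕ) (τ : Finset V) (hτ : τ.card = m + 1) :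
    aA A m τ = (τ.filter (fun u => τ.erase u ∈ A)).card := by
  unfold aA
  symm
  apply Finset.card_bij (fun u _ => τ.erase u)
  · intro u hu
    simp only [Finset.mem_filter, Finset.mem_powersetCard] at hu ⊢
    refine ⟨⟨Finset.erase_subset _ _, ?_⟩, hu.2⟩
    rw [Finset.card_erase_of_mem hu.1]; omega
  · intro a ha b hb hab
    simp only [Finset.mem_filter] at ha hb
    by_contra hne
    have : a ∈ τ.erase b := Finset.mem_erase.mpr ⟨hne, ha.1⟩
    rw [← hab] at this
    simp at this
  · intro s hs
    simp only [Finset.mem_filter, Finset.mem_powersetCard] at hs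
    obtain ⟨⟨h1, h2⟩, h3⟩ := hs
    obtain ⟨u, hu⟩ : ∃ u, τ \ s = {u} := by
      rw [← Finset.card_eq_one, Finset.card_sdiff_of_subset h1]; omega
    have hmem : u ∈ τ \ s := by rw [hu]; simp
    have he : τ.erase u = s := by
      rw [Finset.erase_eq, ← hu, Finset.sdiff_sdiff_eq_self h1]
    exact ⟨u, by simp [he, h3, (Finset.mem_sdiff.mp hmem).1], he⟩

lemma triple_sum (X : Finset (Finset V)) (t k : ℕ) (A : Finset (Finset V)) :
    ∑ τ ∈ powersetCard (k + 2) (univ : Finset V),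
        dg X t τ * ((aA A (k + 1) τ : ℝ) * ((aA A (k + 1) τ : ℝ) - 1)) =
      ∑ σ ∈ powersetCard k (univ : Finset V), Ql X t A σ := by
  have h1 : ∀ τ ∈ powersetCard (k + 2) (univ : Finset V),
      dg X t τ * ((aA A (k + 1) τ : ℝ) * ((aA A (k + 1) τ : ℝ) - 1)) =
      ∑ x ∈ (univ : Finset (V × V)).filter (fun x => x.1 ∈ τ ∧ x.2 ∈ τ ∧ x.1 ≠ x.2 ∧
        τ.erase x.1 ∈ A ∧ τ.erase x.2 ∈ A), dg X t τ := by
    intro τ hτ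
    have hc := (Finset.mem_powersetCard.mp hτ).2
    rw [Finset.sum_const, nsmul_eq_mul, mul_comm]
    congr 1
    have h2 : (univ : Finset (V × V)).filter (fun x => x.1 ∈ τ ∧ x.2 ∈ τ ∧ x.1 ≠ x.2 ∧
        τ.erase x.1 ∈ A ∧ τ.erase x.2 ∈ A) = (τ.filter (fun u => τ.erase u ∈ A)).offDiag := by
      ext x
      simp only [Finset.mem_filter, Finset.mem_univ, true_and, Finset.mem_offDiag]
      tauto
    rw [h2, Finset.offDiag_card, aA_eq A (k + 1) τ hc, Nat.cast_sub (Nat.le_mul_self _)]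
    push_cast; ring
  have h3 : ∀ σ ∈ powersetCard k (univ : Finset V), Ql X t A σ =
      ∑ x ∈ (univ : Finset (V × V)).filter (fun x => x.1 ∉ σ ∧ x.2 ∉ σ ∧ x.1 ≠ x.2 ∧
        insert x.1 σ ∈ A ∧ insert x.2 σ ∈ A), dg X t (insert x.1 (insert x.2 σ)) := by
    intro σ _
    unfold Ql
    rw [Finset.sum_filter, ← Finset.univ_product_univ, Finset.sum_product]
    refine Finset.sum_congr rfl fun u _ => Finset.sum_congr rfl fun v _ => ?_
    unfold We fA
    by_cases a1 : u = v <;> by_cases a2 : u ∈ σ <;> by_cases a3 : v ∈ σ <;>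
      by_cases a4 : insert u σ ∈ A <;> by_cases a5 : insert v σ ∈ A <;>
      simp [a1, a2, a3, a4, a5]
  rw [Finset.sum_congr rfl h1, Finset.sum_congr rfl h3, Finset.sum_sigma', Finset.sum_sigma']
  refine Finset.sum_nbij' (fun x => ⟨(x.1.erase x.2.1).erase x.2.2, x.2⟩)
    (fun x => ⟨insert x.2.1 (insert x.2.2 x.1), x.2⟩) ?_ ?_ ?_ ?_ ?_
  · rintro ⟨τ, u, v⟩ hx
    simp only [Finset.mem_sigma, Finset.mem_powersetCard, Finset.mem_filter, Finset.mem_univ,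
      true_and, Finset.subset_univ] at hx ⊢
    obtain ⟨hc, hu, hv, huv, a, b⟩ := hx
    have e1 : insert v ((τ.erase u).erase v) = τ.erase u :=
      Finset.insert_erase (Finset.mem_erase.mpr ⟨huv.symm, hv⟩)
    have e2 : insert u ((τ.erase u).erase v) = τ.erase v := by
      rw [Finset.erase_right_comm]
      exact Finset.insert_erase (Finset.mem_erase.mpr ⟨huv, hu⟩)
    refine ⟨?_, by simp, by simp, huv, by rwa [e2], by rwa [e1]⟩
    rw [Finset.card_erase_of_mem (Finset.mem_erase.mpr ⟨huv.symm, hv⟩),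
      Finset.card_erase_of_mem hu]
    omega
  · rintro ⟨σ, u, v⟩ hx
    simp only [Finset.mem_sigma, Finset.mem_powersetCard, Finset.mem_filter, Finset.mem_univ,
      true_and, Finset.subset_univ] at hx ⊢
    obtain ⟨hc, hu, hv, huv, a, b⟩ := hx
    have n1 : u ∉ insert v σ := by simp [huv, hu]
    have n2 : v ∉ insert u σ := by simp [huv.symm, hv]
    refine ⟨?_, by simp, by simp, huv, ?_, ?_⟩
    · rw [Finset.card_insert_of_notMem n1, Finset.card_insert_of_notMem hv, hc]
    · rwa [Finset.erase_insert n1]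
    · rwa [Finset.insert_comm, Finset.erase_insert n2]
  · rintro ⟨τ, u, v⟩ hx
    simp only [Finset.mem_sigma, Finset.mem_powersetCard, Finset.mem_filter, Finset.mem_univ,
      true_and, Finset.subset_univ] at hx ⊢
    obtain ⟨hc, hu, hv, huv, a, b⟩ := hx
    rw [Finset.insert_erase (Finset.mem_erase.mpr ⟨huv.symm, hv⟩), Finset.insert_erase hu]
  · rintro ⟨σ, u, v⟩ hx
    simp only [Finset.mem_sigma, Finset.mem_powersetCard, Finset.mem_filter, Finset.mem_univ,
      true_and, Finset.subset_univ] at hx ⊢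
    obtain ⟨hc, hu, hv, huv, a, b⟩ := hx
    rw [Finset.erase_insert (by simp [huv, hu]), Finset.erase_insert hv]
  · rintro ⟨τ, u, v⟩ hx
    simp only [Finset.mem_sigma, Finset.mem_powersetCard, Finset.mem_filter, Finset.mem_univ,
      true_and, Finset.subset_univ] at hx ⊢
    obtain ⟨hc, hu, hv, huv, a, b⟩ := hx
    rw [Finset.insert_erase (Finset.mem_erase.mpr ⟨huv.symm, hv⟩), Finset.insert_erase hu]

lemma flag_Ml (X : Finset (Finset V)) (t k : ℕ) (A B : Finset (Finset V)) :
    ∑ σ ∈ powersetCard k (univ : Finset V), (if σ ∈ B then Ml X t A σ else 0) =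
      ∑ τ ∈ A.filter (fun s => s.card = k + 1), dg X t τ *
        (((τ.powersetCard k).filter (· ∈ B)).card : ℝ) := by
  have h := flag_sum k (fun (σ τ : Finset V) => if τ ∈ A then (if σ ∈ B then dg X t τ else 0) else 0)
  have e1 : ∀ σ ∈ powersetCard k (univ : Finset V), (if σ ∈ B then Ml X t A σ else 0) =
      ∑ u ∈ univ \ σ, (if insert u σ ∈ A then (if σ ∈ B then dg X t (insert u σ) else 0) else 0) := by
    intro σ _
    unfold Ml
    by_cases hB : σ ∈ B <;> simp [hB]
  rw [Finset.sum_congr rfl e1, ← h]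
  have e2 : A.filter (fun s => s.card = k + 1) =
      (powersetCard (k + 1) (univ : Finset V)).filter (· ∈ A) := by
    ext s; simp [and_comm]
  rw [e2, Finset.sum_filter]
  refine Finset.sum_congr rfl fun τ _ => ?_
  by_cases hA : τ ∈ A
  · simp only [hA, if_true]
    rw [← Finset.sum_filter, Finset.sum_const, nsmul_eq_mul, mul_comm]
  · simp [hA]

lemma sum_aA (X : Finset (Finset V)) (t k : ℕ) (A : Finset (Finset V))
    (hA : ∀ s ∈ A, s.card = k + 1) :
    ∑ τ ∈ powersetCard (k + 2) (univ : Finset V), dg X t τ * (aA A (k + 1) τ : ℝ) =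
      ((t : ℝ) - k - 1) * ∑ s ∈ A, dg X t s := by
  have h := flag_sum (k + 1) (fun (σ τ : Finset V) => if σ ∈ A then dg X t τ else 0)
  have e1 : ∀ τ ∈ powersetCard (k + 2) (univ : Finset V), dg X t τ * (aA A (k + 1) τ : ℝ) =
      ∑ σ ∈ powersetCard (k + 1) τ, if σ ∈ A then dg X t τ else 0 := by
    intro τ _
    rw [← Finset.sum_filter, Finset.sum_const, nsmul_eq_mul, mul_comm]
    rfl
  rw [Finset.sum_congr rfl e1]
  rw [show k + 2 = k + 1 + 1 from rfl, h, Finset.mul_sum]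
  have e2 : A = (powersetCard (k + 1) (univ : Finset V)).filter (· ∈ A) := by
    ext s; simp only [Finset.mem_filter, Finset.mem_powersetCard, Finset.subset_univ, true_and]
    exact ⟨fun h => ⟨hA s h, h⟩, fun h => h.2⟩
  conv_rhs => rw [e2]
  rw [Finset.sum_filter]
  refine Finset.sum_congr rfl fun σ hσ => ?_
  by_cases hs : σ ∈ A
  · simp only [hs, if_true]
    rw [sum_dg_insert, hA σ hs]
    push_cast; ring
  · simp [hs]

lemma dg_pos_mem (X : Finset (Finset V)) (hX : IsComplex X) (t : ℕ) (s : Finset V)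
    (h : dg X t s ≠ 0) : s ∈ X := by
  unfold dg at h
  have h1 : ((facesCard X t).filter fun ρ => s ⊆ ρ).card ≠ 0 := by exact_mod_cast h
  obtain ⟨ρ, hρ⟩ := Finset.card_ne_zero.mp h1
  rw [Finset.mem_filter] at hρ
  exact hX ρ (Finset.mem_filter.mp hρ.1).1 s hρ.2

lemma delta_sum (X : Finset (Finset V)) (hX : IsComplex X) (t k : ℕ) (A : Finset (Finset V)) :
    ∑ τ ∈ (delta1 X (k + 1) A).filter (fun s => s.card = k + 2), dg X t τ =
      ∑ τ ∈ powersetCard (k + 2) (univ : Finset V),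
        if aA A (k + 1) τ = 1 then dg X t τ else 0 := by
  rw [← Finset.sum_filter]
  apply Finset.sum_subset
  · intro τ hτ
    simp only [delta1, facesCard, Finset.mem_filter] at hτ
    simp only [Finset.mem_filter, Finset.mem_powersetCard, Finset.subset_univ, true_and]
    exact ⟨hτ.2, hτ.1.2⟩
  · intro τ h1 h2
    simp only [Finset.mem_filter, Finset.mem_powersetCard, Finset.subset_univ, true_and] at h1
    by_contra hne
    apply h2
    simp only [delta1, facesCard, Finset.mem_filter]
    exact ⟨⟨⟨dg_pos_mem X hX t τ hne, h1.1⟩, h1.2⟩, h1.1⟩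

lemma main_counts (X : Finset (Finset V)) (d : ℕ) (lam η ε : ℝ)
    (hX : IsComplex X) (hlse : IsLocalSpectralExpander X d lam)
    (hη0 : 0 < η) (hη1 : η < 1) (hε0 : 0 < ε) (hε1 : ε < 1)
    (k : ℕ) (hk : k + 1 ≤ d) (A : Finset (Finset V)) (hA : ∀ s ∈ A, s.card = k + 1)
    (hnl : (1 - ε) * ((k + 1) * ∑ s ∈ A, dg X (d + 1) s) ≤
      ∑ σ ∈ powersetCard k (univ : Finset V),
        (if σ ∈ nonlocalS X (d + 1) k A η then Ml X (d + 1) A σ else 0)) :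
    ∑ σ ∈ powersetCard k (univ : Finset V), Ql X (d + 1) A σ ≤
      ((d : ℝ) - k) * ((k + 1) * (lam + η + ε) * ∑ s ∈ A, dg X (d + 1) s) := by
  set S := nonlocalS X (d + 1) k A η with hS
  set DA := ∑ s ∈ A, dg X (d + 1) s with hDA
  have hkd : (k : ℝ) + 1 ≤ d := by exact_mod_cast hk
  have hDA0 : 0 ≤ DA := Finset.sum_nonneg fun s _ => dg_nonneg _ _ _
  have hfA : A.filter (fun s => s.card = k + 1) = A := Finset.filter_eq_self.mpr hA
  have hall : ∑ σ ∈ powersetCard k (univ : Finset V), Ml X (d + 1) A σ = (k + 1) * DA := by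
    have := flag_Ml X (d + 1) k A univ
    rw [hfA] at this
    simp only [Finset.mem_univ, if_true] at this
    rw [this, hDA, Finset.mul_sum]
    refine Finset.sum_congr rfl fun τ hτ => ?_
    rw [Finset.filter_true_of_mem (fun _ _ => trivial), Finset.card_powersetCard, hA τ hτ,
      Nat.choose_succ_self_right]
    push_cast; ring
  have hgood : ∀ σ ∈ powersetCard k (univ : Finset V), σ ∈ S →
      Ql X (d + 1) A σ ≤ (lam + η) * (((d : ℝ) - k) * Ml X (d + 1) A σ) ∧
      (Ml X (d + 1) A σ = 0 ∨ 0 ≤ lam) := by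
    intro σ hσ hσS
    have hc := (Finset.mem_powersetCard.mp hσ).2
    simp only [hS, nonlocalS, facesCard, Finset.mem_filter] at hσS
    have hle := Ql_le X (d + 1) A σ
    rcases (dg_nonneg X (d + 1) σ).eq_or_lt with h0 | h0
    · have hM : Ml X (d + 1) A σ = 0 := by
        unfold Ml
        apply Finset.sum_eq_zero
        intro u hu
        have hz := sum_dg_insert X (d + 1) σ
        rw [← h0, mul_zero] at hz
        have := (Finset.sum_eq_zero_iff_of_nonneg (fun v _ => dg_nonneg X (d + 1) _)).mp hz u hu
        simp [this]
      rw [hM] at hle ⊢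
      refine ⟨by linarith, Or.inl rfl⟩
    · have := Ql_good X d k lam η hlse hη1 A σ hσS.1.1 hc hk h0 hσS.2
      refine ⟨?_, this.2⟩
      have h2 := this.1
      have e : (((d + 1 : ℕ) : ℝ) - k - 1) = (d : ℝ) - k := by push_cast; ring
      rwa [e] at h2
  have hbad : ∀ σ ∈ powersetCard k (univ : Finset V),
      Ql X (d + 1) A σ ≤ ((d : ℝ) - k) * Ml X (d + 1) A σ := by
    intro σ hσ
    have hc := (Finset.mem_powersetCard.mp hσ).2
    have := Ql_le X (d + 1) A σ
    rw [hc] at this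
    have e : (((d + 1 : ℕ) : ℝ) - k - 1) = (d : ℝ) - k := by push_cast; ring
    rwa [e] at this
  set MS := ∑ σ ∈ powersetCard k (univ : Finset V),
        (if σ ∈ S then Ml X (d + 1) A σ else 0) with hMS
  have hsum : ∑ σ ∈ powersetCard k (univ : Finset V), Ql X (d + 1) A σ ≤
      ((d : ℝ) - k) * ((lam + η) * MS + ((k + 1) * DA - MS)) := by
    rw [← hall, hMS, ← Finset.sum_sub_distrib, Finset.mul_sum, ← Finset.sum_add_distrib,
      Finset.mul_sum]
    refine Finset.sum_le_sum fun σ hσ => ?_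
    by_cases h : σ ∈ S
    · have := (hgood σ hσ h).1
      simp only [h, if_true]
      linarith
    · have := hbad σ hσ
      simp only [h, if_false]
      linarith
  have hMSle : MS ≤ (k + 1) * DA := by
    rw [← hall, hMS]
    refine Finset.sum_le_sum fun σ _ => ?_
    split_ifs
    · exact le_rfl
    · exact Ml_nonneg _ _ _ _
  have hcase : MS = 0 ∨ 0 ≤ lam := by
    by_cases hl : 0 ≤ lam
    · exact Or.inr hl
    · left
      rw [hMS]
      refine Finset.sum_eq_zero fun σ hσ => ?_
      split_ifs with h
      · exact ((hgood σ hσ h).2).resolve_right hl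
      · rfl
  have hfin : (lam + η) * MS + ((k + 1) * DA - MS) ≤ (k + 1) * (lam + η + ε) * DA := by
    rcases hcase with h | h
    · have hk1 : (0 : ℝ) < k + 1 := by positivity
      have : (k + 1) * DA ≤ 0 := by
        rw [h] at hnl
        by_contra hc
        push Not at hc
        have := mul_pos (sub_pos.mpr hε1) hc
        linarith
      have h0 : DA = 0 := by
        apply le_antisymm _ hDA0
        by_contra hc
        push Not at hc
        have := mul_pos hk1 hc
        linarith
      rw [h, h0]; simp
    · nlinarith [mul_nonneg (add_nonneg h hη0.le) (sub_nonneg.mpr hMSle)]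
  refine hsum.trans (mul_le_mul_of_nonneg_left hfin (by linarith))

lemma indicator_bound (k a : ℕ) (ha : a ≤ k + 2) :
    (a : ℝ) / (k + 2) - (a : ℝ) * (a - 1) / 2 ≤ if a = 1 then 1 else 0 := by
  have hk : (0 : ℝ) < (k : ℝ) + 2 := by positivity
  have h1 : (a : ℝ) / (k + 2) ≤ 1 := by
    rw [div_le_one hk]; exact_mod_cast ha
  rcases a with _ | _ | a
  · simp
  · simp at h1 ⊢; exact h1
  · rw [if_neg (by omega)]
    push_cast at h1 ⊢
    nlinarith [(Nat.cast_nonneg a : (0 : ℝ) ≤ a)]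

end HDX

/-- Non-local sets are δ₁-expanding: Let `X` be a `d`-dimensional
`λ`-local spectral expander and `0 < η, ε < 1`.  For any `(η,ε)`-non-local set of `k`-faces
`A ⊆ X(k)`, `0 ≤ k ≤ d-1`, one has
`‖δ₁(A)‖ ≥ (1 - C(k+2,k)(λ + η + 2ε)) ‖A‖`. -/
theorem stmt0 {V : Type*} [Fintype V] [DecidableEq V]
    (X : Finset (Finset V)) (d : ℕ) (lam η ε : ℝ)
    (hX : HDX.IsComplex X) (hXd : HDX.IsPureDim X d)
    (hlse : HDX.IsLocalSpectralExpander X d lam)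
    (hη0 : 0 < η) (hη1 : η < 1) (hε0 : 0 < ε) (hε1 : ε < 1)
    (k : ℕ) (hk : k + 1 ≤ d)
    (A : Finset (Finset V)) (hA : A ⊆ HDX.facesCard X (k + 1))
    (hnl : HDX.IsNonlocal X (d + 1) k A η ε) :
    HDX.wt X (d + 1) (k + 2) (HDX.delta1 X (k + 1) A) ≥
      (1 - ((k + 2).choose k : ℝ) * (lam + η + 2 * ε)) * HDX.wt X (d + 1) (k + 1) A := by
  have hA' : ∀ s ∈ A, s.card = k + 1 := fun s hs => (Finset.mem_filter.mp (hA hs)).2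
  have hkd : (k : ℝ) + 1 ≤ d := by exact_mod_cast hk
  have hfA : A.filter (fun s => s.card = k + 1) = A := Finset.filter_eq_self.mpr hA'
  have hN : (0 : ℝ) < ((HDX.facesCard X (d + 1)).card : ℝ) := by
    obtain ⟨⟨s, hs⟩, _, h3⟩ := hXd
    obtain ⟨τ, hτ, _, hc⟩ := h3 s hs
    have : 0 < (HDX.facesCard X (d + 1)).card :=
      Finset.card_pos.mpr ⟨τ, Finset.mem_filter.mpr ⟨hτ, hc⟩⟩
    exact_mod_cast this
  have hC1 : (0 : ℝ) < ((d + 1).choose (k + 1) : ℝ) := by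
    exact_mod_cast Nat.choose_pos (by omega)
  have hC2 : (0 : ℝ) < ((d + 1).choose (k + 2) : ℝ) := by
    exact_mod_cast Nat.choose_pos (by omega)
  have hCC : ((d + 1).choose (k + 2) : ℝ) * (k + 2) = ((d + 1).choose (k + 1) : ℝ) * (d - k) := by
    have h := Nat.choose_succ_right_eq (d + 1) (k + 1)
    have e : d + 1 - (k + 1) = d - k := by omega
    rw [e] at h
    have h' : (((d + 1).choose (k + 1 + 1) * (k + 1 + 1) : ℕ) : ℝ) =
        (((d + 1).choose (k + 1) * (d - k) : ℕ) : ℝ) := by rw [h]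
    push_cast [Nat.cast_sub (show k ≤ d by omega)] at h'
    rw [show k + 2 = k + 1 + 1 from rfl]
    linarith
  have hch : ((k + 2).choose k : ℝ) = (k + 2) * (k + 1) / 2 := by
    rw [Nat.choose_symm_add, Nat.cast_choose_two]
    push_cast; ring
  set DA := ∑ s ∈ A, HDX.dg X (d + 1) s with hDA
  have hDA0 : 0 ≤ DA := Finset.sum_nonneg fun s _ => HDX.dg_nonneg _ _ _
  have hwA : HDX.wt X (d + 1) (k + 1) A =
      DA / (((HDX.facesCard X (d + 1)).card : ℝ) * ((d + 1).choose (k + 1) : ℝ)) := by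
    rw [HDX.wt_eq, hfA]
  have hnl' : (1 - ε) * ((k + 1) * DA) ≤
      ∑ σ ∈ powersetCard k (univ : Finset V),
        (if σ ∈ HDX.nonlocalS X (d + 1) k A η then HDX.Ml X (d + 1) A σ else 0) := by
    rw [HDX.flag_Ml]
    have h := hnl
    unfold HDX.IsNonlocal at h
    rw [HDX.mwt_eq, hwA, ge_iff_le, Nat.choose_succ_self_right, ← mul_div_assoc,
      div_le_div_iff₀ (by positivity) (by positivity)] at h
    push_cast at h
    have hp : 0 < ((HDX.facesCard X (d + 1)).card : ℝ) * ((d + 1).choose (k + 1) : ℝ) := by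
      positivity
    refine le_of_mul_le_mul_right ?_ hp
    linarith
  have hmain := HDX.main_counts X d lam η ε hX hlse hη0 hη1 hε0 hε1 k hk A hA' hnl'
  rw [← HDX.triple_sum] at hmain
  have hs1 := HDX.sum_aA X (d + 1) k A hA'
  have hδ : (((d : ℝ) - k) / (k + 2)) * DA -
      (((d : ℝ) - k) * ((k + 1) * (lam + η + ε) * DA)) / 2 ≤
      ∑ τ ∈ (HDX.delta1 X (k + 1) A).filter (fun s => s.card = k + 2), HDX.dg X (d + 1) τ := by
    rw [HDX.delta_sum X hX]
    have hlow : ∑ τ ∈ powersetCard (k + 2) (univ : Finset V),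
        (HDX.dg X (d + 1) τ * (HDX.aA A (k + 1) τ : ℝ) * (1 / (k + 2)) -
          HDX.dg X (d + 1) τ * ((HDX.aA A (k + 1) τ : ℝ) * ((HDX.aA A (k + 1) τ : ℝ) - 1)) * (1 / 2))
        ≤ ∑ τ ∈ powersetCard (k + 2) (univ : Finset V),
        if HDX.aA A (k + 1) τ = 1 then HDX.dg X (d + 1) τ else 0 := by
      refine Finset.sum_le_sum fun τ hτ => ?_
      have hc := (Finset.mem_powersetCard.mp hτ).2
      have ha : HDX.aA A (k + 1) τ ≤ k + 2 := by
        rw [HDX.aA_eq A (k + 1) τ hc, ← hc]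
        exact Finset.card_filter_le _ _
      have hb := mul_le_mul_of_nonneg_left (HDX.indicator_bound k _ ha)
        (HDX.dg_nonneg X (d + 1) τ)
      have e : HDX.dg X (d + 1) τ * (if HDX.aA A (k + 1) τ = 1 then (1 : ℝ) else 0) =
          if HDX.aA A (k + 1) τ = 1 then HDX.dg X (d + 1) τ else 0 := by
        split_ifs <;> simp
      rw [e] at hb
      refine le_trans (le_of_eq ?_) hb
      ring
    rw [Finset.sum_sub_distrib, ← Finset.sum_mul, ← Finset.sum_mul, hs1] at hlow
    refine le_trans ?_ hlow
    have e : (((d + 1 : ℕ) : ℝ) - k - 1) * DA * (1 / (k + 2)) = (((d : ℝ) - k) / (k + 2)) * DA := by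
      push_cast; ring
    rw [e]
    linarith
  rw [ge_iff_le, hwA, HDX.wt_eq, hch, ← mul_div_assoc, div_le_div_iff₀ (by positivity) (by positivity)]
  have hk2 : (0 : ℝ) < (k : ℝ) + 2 := by positivity
  have hfin : (1 - ((k : ℝ) + 2) * (k + 1) / 2 * (lam + η + 2 * ε)) * DA * (d - k) / (k + 2) ≤
      ∑ τ ∈ (HDX.delta1 X (k + 1) A).filter (fun s => s.card = k + 2), HDX.dg X (d + 1) τ := by
    refine le_trans ?_ hδ
    have e : (((d : ℝ) - k) / (k + 2)) * DA -
        (((d : ℝ) - k) * ((k + 1) * (lam + η + ε) * DA)) / 2 -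
        (1 - ((k : ℝ) + 2) * (k + 1) / 2 * (lam + η + 2 * ε)) * DA * (d - k) / (k + 2) =
        ((d : ℝ) - k) * (k + 1) * ε * DA / 2 := by
      field_simp; ring
    have : 0 ≤ ((d : ℝ) - k) * (k + 1) * ε * DA / 2 := by
      have : (0 : ℝ) ≤ (d : ℝ) - k := by linarith
      positivity
    linarith
  have hC2' : ((d + 1).choose (k + 2) : ℝ) = ((d + 1).choose (k + 1) : ℝ) * (d - k) / (k + 2) := by
    rw [eq_div_iff hk2.ne', hCC]
  rw [hC2']
  have hp : 0 ≤ ((HDX.facesCard X (d + 1)).card : ℝ) * ((d + 1).choose (k + 1) : ℝ) := by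
    positivity
  have := mul_le_mul_of_nonneg_right hfin hp
  refine le_trans (le_of_eq ?_) this
  ring
end

section
/- Fix d ∈ ℕ, an abelian group G, and 0 < λ, η, ε < 1 with λ + η + 2ε ≤ 2/(d+1)². Let X be a d-dimensional λ-local spectral expander. For any cocycle f ∈ Z^k(X;G) with 0 ≤ k ≤ d−1, if the support of f is an (η,ε)-non-local subset of X(k), then f = 0. -/
/- Common framework: weighted simplicial complexes, links, localizations,
   local spectral expansion, cochains, coboundaries, minimality, etc. -/

open Finset

open scoped Classical

namespace HDXP
open HDX
variable {V : Type*} [Fintype V] [DecidableEq V]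

lemma cocycle_step {G : Type*} [AddCommGroup G] (X : Finset (Finset V)) (hX : IsComplex X)
    (k : ℕ) (f : (Fin (k + 1) → V) → G) (hf : IsCocycle X f)
    (a : Finset V) (ha : a ∈ suppC X f) (v : V) (hv : v ∉ a) (hva : insert v a ∈ X) :
    ∃ u ∈ a, insert v (a.erase u) ∈ suppC X f := by
  obtain ⟨hf1, hf2⟩ := hf
  obtain ⟨-, tup, rfl, hne⟩ := Finset.mem_filter.1 ha
  have hft : IsFaceTup X tup := by
    by_contra h
    exact hne (hf1.2 _ h)
  have hv' : ∀ i, tup i ≠ v := by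
    intro i h
    exact hv (Finset.mem_image.2 ⟨i, Finset.mem_univ _, h⟩)
  have hinj : Function.Injective (Fin.cons v tup : Fin (k+2) → V) := by
    rw [Fin.cons_injective_iff]
    exact ⟨fun ⟨i, hi⟩ => hv' i hi, hft.1⟩
  have him : Finset.image (Fin.cons v tup : Fin (k+2) → V) Finset.univ
      = insert v (Finset.image tup Finset.univ) := by
    ext x
    simp [Fin.exists_fin_succ, eq_comm]
  have h0 := hf2 (Fin.cons v tup) ⟨hinj, him ▸ hva⟩
  unfold cob at h0
  rw [Fin.sum_univ_succ] at h0
  have : ∃ j : Fin (k+1), f ((Fin.cons v tup : Fin (k+2) → V) ∘ (Fin.succ j).succAbove) ≠ 0 := by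
    by_contra! hall
    simp only [hall, smul_zero, Finset.sum_const_zero, add_zero] at h0
    apply hne
    simpa using h0
  obtain ⟨j, hj⟩ := this
  refine ⟨tup j, Finset.mem_image_of_mem _ (Finset.mem_univ _), ?_⟩
  have hft2 : IsFaceTup X ((Fin.cons v tup : Fin (k+2) → V) ∘ (Fin.succ j).succAbove) := by
    by_contra h
    exact hj (hf1.2 _ h)
  have him2 : Finset.image ((Fin.cons v tup : Fin (k+2) → V) ∘ (Fin.succ j).succAbove) Finset.univ
      = insert v ((Finset.image tup Finset.univ).erase (tup j)) := by
    ext x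
    simp only [Finset.mem_image, Finset.mem_univ, true_and, Finset.mem_insert, Finset.mem_erase,
      Function.comp]
    constructor
    · rintro ⟨i, rfl⟩
      have h1 : (Fin.succ j).succAbove i ≠ Fin.succ j := Fin.succAbove_ne _ _
      generalize (Fin.succ j).succAbove i = q at h1
      induction q using Fin.cases with
      | zero => left; simp
      | succ q =>
        right
        simp only [Fin.cons_succ]
        exact ⟨fun h => h1 (by rw [hft.1 h]), q, rfl⟩
    · rintro (rfl | ⟨hx, q, rfl⟩)
      · obtain ⟨i, hi⟩ := Fin.exists_succAbove_eq (x := (0 : Fin (k+2))) (y := Fin.succ j)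
          (Fin.succ_ne_zero j).symm
        exact ⟨i, by rw [hi]; simp⟩
      · obtain ⟨i, hi⟩ := Fin.exists_succAbove_eq (x := Fin.succ q) (y := Fin.succ j)
          (fun h => hx (by rw [Fin.succ_injective _ h]))
        exact ⟨i, by rw [hi]; simp⟩
  refine Finset.mem_filter.2 ⟨Finset.mem_filter.2 ⟨him2 ▸ hft2.2, ?_⟩, _, him2, hj⟩
  rw [← him2, Finset.card_image_of_injective _ hft2.1]
  simp

/-- reindexing pairs (σ,u) by (a,u) -/
lemma reindex (t : Finset V) (k : ℕ) (g : Finset V → V → ℝ) :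
    ∑ s ∈ t.powersetCard k, ∑ u ∈ t \ s, g s u
      = ∑ a ∈ t.powersetCard (k+1), ∑ u ∈ a, g (a.erase u) u := by
  rw [Finset.sum_sigma', Finset.sum_sigma']
  refine Finset.sum_bij' (fun p _ => ⟨insert p.2 p.1, p.2⟩) (fun p _ => ⟨p.1.erase p.2, p.2⟩)
    ?_ ?_ ?_ ?_ ?_
  · rintro ⟨s, u⟩ h
    simp only [Finset.mem_sigma, Finset.mem_powersetCard, Finset.mem_sdiff] at h ⊢
    refine ⟨⟨Finset.insert_subset h.2.1 h.1.1, ?_⟩, Finset.mem_insert_self _ _⟩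
    rw [Finset.card_insert_of_notMem h.2.2, h.1.2]
  · rintro ⟨a, u⟩ h
    simp only [Finset.mem_sigma, Finset.mem_powersetCard, Finset.mem_sdiff] at h ⊢
    refine ⟨⟨(Finset.erase_subset _ _).trans h.1.1, ?_⟩, h.1.1 h.2, Finset.notMem_erase _ _⟩
    rw [Finset.card_erase_of_mem h.2, h.1.2]; rfl
  · rintro ⟨s, u⟩ h
    simp only [Finset.mem_sigma, Finset.mem_powersetCard, Finset.mem_sdiff] at h ⊢
    simp [Finset.erase_insert h.2.2]
  · rintro ⟨a, u⟩ h
    simp only [Finset.mem_sigma, Finset.mem_powersetCard, Finset.mem_sdiff] at h ⊢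
    simp [Finset.insert_erase h.2]
  · rintro ⟨s, u⟩ h
    simp only [Finset.mem_sigma, Finset.mem_powersetCard, Finset.mem_sdiff] at h ⊢
    simp [Finset.erase_insert h.2.2]

lemma sum_facets (a : Finset V) (k : ℕ) (ha : a.card = k + 1) (h : Finset V → ℝ) :
    ∑ s ∈ a.powersetCard k, h s = ∑ u ∈ a, h (a.erase u) := by
  symm
  refine Finset.sum_bij (fun u _ => a.erase u) ?_ ?_ ?_ ?_
  · intro u hu
    rw [Finset.mem_powersetCard, Finset.card_erase_of_mem hu, ha]
    exact ⟨Finset.erase_subset _ _, rfl⟩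
  · intro u hu v hv h
    exact Finset.erase_injOn a hu hv h
  · intro s hs
    rw [Finset.mem_powersetCard] at hs
    have : (a \ s).card = 1 := by rw [Finset.card_sdiff_of_subset hs.1]; omega
    obtain ⟨u, hu⟩ := Finset.card_eq_one.1 this
    have hu' : u ∈ a \ s := by rw [hu]; simp
    refine ⟨u, (Finset.mem_sdiff.1 hu').1, ?_⟩
    rw [Finset.erase_eq, ← hu, Finset.sdiff_sdiff_eq_self hs.1]
  · intros; rfl

lemma pair_count (s : Finset V) (b c : V → ℝ) :
    ∑ u, ∑ v, (if u ≠ v ∧ u ∈ s ∧ v ∈ s then (1:ℝ) else 0) * b u * c v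
      = ∑ u ∈ s, ∑ v ∈ s.erase u, b u * c v := by
  rw [← Finset.sum_subset (Finset.subset_univ s)]
  · refine Finset.sum_congr rfl fun u hu => ?_
    rw [← Finset.sum_subset (Finset.subset_univ (s.erase u))]
    · refine Finset.sum_congr rfl fun v hv => ?_
      rw [Finset.mem_erase] at hv
      rw [if_pos ⟨hv.1.symm, hu, hv.2⟩, one_mul]
    · intro v _ hv
      rw [if_neg]
      · ring
      · rintro ⟨h1, _, h2⟩
        exact hv (Finset.mem_erase.2 ⟨h1.symm, h2⟩)
  · intro u _ hu
    refine Finset.sum_eq_zero fun v _ => ?_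
    rw [if_neg (by tauto)]; ring

lemma edgeWt_eq (Y : Finset (Finset V)) (t : ℕ) (u v : V) :
    edgeWt Y t u v = (∑ s ∈ facesCard Y t, if u ≠ v ∧ u ∈ s ∧ v ∈ s then (1:ℝ) else 0) /
      (((facesCard Y t).card : ℝ) * (t.choose 2 : ℝ)) := by
  unfold edgeWt wt
  by_cases h : u = v
  · simp [h]
  · rw [if_pos h]
    congr 1
    refine Finset.sum_congr rfl fun s _ => ?_
    by_cases h2 : u ∈ s ∧ v ∈ s
    · rw [if_pos ⟨h, h2⟩]
      have : {x ∈ Finset.powersetCard 2 s | x ∈ ({{u, v}} : Finset (Finset V))} = {{u, v}} := by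
        ext x
        simp only [Finset.mem_filter, Finset.mem_powersetCard, Finset.mem_singleton]
        constructor
        · exact fun h => h.2
        · rintro rfl
          exact ⟨⟨by simp [Finset.insert_subset_iff, h2], Finset.card_pair h⟩, rfl⟩
      rw [this]; simp
    · rw [if_neg (by tauto)]
      rw [Finset.filter_eq_empty_iff.2]; · simp
      intro x hx hx2
      rw [Finset.mem_singleton] at hx2
      subst hx2
      rw [Finset.mem_powersetCard] at hx
      exact h2 ⟨hx.1 (by simp), hx.1 (by simp)⟩

/-- mixing lemma in a weighted graph -/
lemma mixing (w : V → V → ℝ) (hsym : ∀ u v, w u v = w v u) (lam : ℝ) (hl : 0 ≤ lam)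
    (h : IsSpectralExpanderW w lam) (b : V → ℝ) (hb : ∀ u, b u ^ 2 = b u)
    (hW : 0 < ∑ u, ∑ v, w u v) :
    ∑ u, ∑ v, w u v * b u * b v ≤
      ((∑ u, (∑ v, w u v) * b u) / (∑ u, ∑ v, w u v) + lam) * ∑ u, (∑ v, w u v) * b u := by
  set W := ∑ u, ∑ v, w u v with hWd
  set D := ∑ u, (∑ v, w u v) * b u with hD
  set m := D / W with hm
  have hmW : m * W = D := by rw [hm]; field_simp
  have hD2 : ∑ u, ∑ v, w u v * b v = D := by
    rw [Finset.sum_comm, hD]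
    refine Finset.sum_congr rfl fun u _ => ?_
    rw [Finset.sum_mul]
    exact Finset.sum_congr rfl fun v _ => by rw [hsym]
  have hD3 : ∑ u, ∑ v, w u v * b u = D := by
    rw [hD]
    exact Finset.sum_congr rfl fun u _ => by rw [Finset.sum_mul]
  have h1 := h (fun u => b u - m) (by
    have : ∀ u, (∑ v, w u v) * (b u - m) = (∑ v, w u v) * b u - m * (∑ v, w u v) := by
      intro u; ring
    simp only [this, Finset.sum_sub_distrib, ← Finset.mul_sum]
    rw [← hWd, ← hD]; linarith)
  have e1 : ∑ u, ∑ v, w u v * (b u - m) * (b v - m)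
      = (∑ u, ∑ v, w u v * b u * b v) - m * D := by
    have : ∀ u v, w u v * (b u - m) * (b v - m)
      = w u v * b u * b v - m * (w u v * b u) - m * (w u v * b v) + m * m * w u v := by
      intro u v; ring
    simp only [this, Finset.sum_sub_distrib, Finset.sum_add_distrib, ← Finset.mul_sum]
    rw [hD2, hD3, ← hWd, ← hmW]; ring
  have e2 : ∑ u, (∑ v, w u v) * (b u - m) ^ 2 = D - m * D := by
    have : ∀ u, (∑ v, w u v) * (b u - m)^2
      = (∑ v, w u v) * b u - 2 * m * ((∑ v, w u v) * b u) + m * m * (∑ v, w u v) := by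
      intro u
      have := hb u
      linear_combination (∑ v, w u v) * this
    simp only [this, Finset.sum_sub_distrib, Finset.sum_add_distrib, ← Finset.mul_sum]
    rw [← hWd, ← hD, ← hmW]; ring
  simp only [e1, e2] at h1
  have h2 := (abs_le.1 h1).2
  have h3 : 0 ≤ m * D := by
    rw [hm, div_mul_eq_mul_div]; exact div_nonneg (mul_self_nonneg _) hW.le
  nlinarith [mul_nonneg hl h3]

lemma expander_scale (w : V → V → ℝ) (lam C : ℝ) (hC : 0 < C)
    (h : IsSpectralExpanderW (fun u v => w u v / C) lam) : IsSpectralExpanderW w lam := by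
  intro f hf
  have h1 := h f (by
    simp only [← Finset.sum_div, div_mul_eq_mul_div]
    rw [hf, zero_div])
  simp only [← Finset.sum_div, div_mul_eq_mul_div, abs_div, abs_of_pos hC, ← mul_div_assoc] at h1
  exact (div_le_div_iff_of_pos_right hC).1 h1

lemma mixing_top (F : Finset (Finset V)) (s : ℕ) (hs : 2 ≤ s) (hF : F.Nonempty)
    (hFs : ∀ t ∈ F, t.card = s) (lam : ℝ) (hl : 0 ≤ lam) (C : ℝ) (hC : 0 < C)
    (h : IsSpectralExpanderW (fun u v => (∑ t ∈ F, if u ≠ v ∧ u ∈ t ∧ v ∈ t then (1:ℝ) else 0) / C) lam)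
    (b : V → ℝ) (hb : ∀ u, b u ^ 2 = b u) :
    ∑ t ∈ F, ∑ u ∈ t, ∑ v ∈ t.erase u, b u * b v ≤
      ((∑ t ∈ F, ∑ u ∈ t, b u) / (F.card * s) + lam) * ((s - 1) * ∑ t ∈ F, ∑ u ∈ t, b u) := by
  have hs' : (2:ℝ) ≤ s := by exact_mod_cast hs
  have hFc : (0:ℝ) < F.card := by exact_mod_cast hF.card_pos
  have h' := expander_scale _ lam C hC h
  set w : V → V → ℝ := fun u v => (∑ t ∈ F, if u ≠ v ∧ u ∈ t ∧ v ∈ t then (1:ℝ) else 0) with hwdef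
  have key : ∀ b c : V → ℝ, ∑ u, ∑ v, w u v * b u * c v
      = ∑ t ∈ F, ∑ u ∈ t, ∑ v ∈ t.erase u, b u * c v := by
    intro b c
    simp only [← pair_count]
    simp only [hwdef, Finset.sum_mul]
    rw [Finset.sum_comm (s := F)]
    refine Finset.sum_congr rfl fun u _ => ?_
    rw [Finset.sum_comm]
  have key1 : ∀ b : V → ℝ, ∑ u, (∑ v, w u v) * b u = (s - 1) * ∑ t ∈ F, ∑ u ∈ t, b u := by
    intro b
    have h1 := key b (fun _ => 1)
    simp only [mul_one] at h1
    simp only [Finset.sum_mul]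
    rw [h1, Finset.mul_sum]
    refine Finset.sum_congr rfl fun t ht => ?_
    rw [Finset.mul_sum]
    refine Finset.sum_congr rfl fun u hu => ?_
    rw [Finset.sum_const, Finset.card_erase_of_mem hu, hFs t ht, nsmul_eq_mul]
    push_cast [Nat.cast_sub (show 1 ≤ s by omega)]
    ring
  have key2 : ∑ u, ∑ v, w u v = (s - 1) * (F.card * s) := by
    have h1 := key1 (fun _ => 1)
    simp only [mul_one] at h1
    rw [h1]
    congr 1
    rw [Finset.sum_congr rfl (fun t ht => show ∑ u ∈ t, (1:ℝ) = s by simp [hFs t ht])]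
    simp
  have hW : 0 < ∑ u, ∑ v, w u v := by
    rw [key2]; apply mul_pos (by linarith); apply mul_pos hFc; linarith
  have := mixing w (fun u v => by
      simp only [hwdef]
      refine Finset.sum_congr rfl fun t _ => ?_
      congr 1
      apply propext; constructor <;> (rintro ⟨a, b, c⟩; exact ⟨a.symm, c, b⟩)) lam hl h' b hb hW
  rw [key, key1, key2, mul_div_mul_left _ _ (by linarith : (s:ℝ) - 1 ≠ 0)] at this
  exact this

lemma sum_link (X : Finset (Finset V)) (σ : Finset V) (t : ℕ) (g : Finset V → ℝ)
    (hσ : σ.card ≤ t) :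
    ∑ ρ ∈ facesCard (link X σ) (t - σ.card), g ρ
      = ∑ τ ∈ (facesCard X t).filter (fun τ => σ ⊆ τ), g (τ \ σ) := by
  have : facesCard (link X σ) (t - σ.card)
      = ((facesCard X t).filter (fun τ => σ ⊆ τ)).image (fun τ => τ \ σ) := by
    ext ρ
    simp only [facesCard, link, localize, Finset.mem_filter, Finset.mem_image]
    constructor
    · rintro ⟨⟨τ, ⟨h1, h2⟩, rfl⟩, h3⟩
      refine ⟨τ, ⟨⟨h1, ?_⟩, h2⟩, rfl⟩
      rw [Finset.card_sdiff_of_subset h2] at h3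
      have := Finset.card_le_card h2
      omega
    · rintro ⟨τ, ⟨⟨h1, h3⟩, h2⟩, rfl⟩
      refine ⟨⟨τ, ⟨h1, h2⟩, rfl⟩, ?_⟩
      rw [Finset.card_sdiff_of_subset h2, h3]
  rw [this, Finset.sum_image]
  intro a ha b hb hab
  simp only [Finset.coe_filter, Set.mem_setOf_eq] at ha hb hab
  rw [← Finset.sdiff_union_of_subset ha.2, hab, Finset.sdiff_union_of_subset hb.2]

/-- indicator of the localization on vertices -/
noncomputable def ind (A : Finset (Finset V)) (σ : Finset V) (u : V) : ℝ :=
  if insert u σ ∈ A then 1 else 0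

noncomputable def LL (X : Finset (Finset V)) (t : ℕ) (A : Finset (Finset V)) (σ : Finset V) : ℝ :=
  ∑ τ ∈ (facesCard X t).filter (fun τ => σ ⊆ τ), ∑ u ∈ τ \ σ, ind A σ u

noncomputable def EE (X : Finset (Finset V)) (t : ℕ) (A : Finset (Finset V)) (σ : Finset V) : ℝ :=
  ∑ τ ∈ (facesCard X t).filter (fun τ => σ ⊆ τ),
    ∑ u ∈ τ \ σ, ∑ v ∈ (τ \ σ).erase u, ind A σ u * ind A σ v

lemma locWt_eq (X : Finset (Finset V)) (t k : ℕ) (A : Finset (Finset V)) (σ : Finset V)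
    (hσ : σ.card = k) (hk : k + 2 ≤ t) :
    locWt X t A (k + 1) σ =
      LL X t A σ / ((facesCard (link X σ) (t - σ.card)).card * (t - σ.card : ℕ)) := by
  unfold locWt wt LL
  rw [sum_link _ _ _ _ (by omega)]
  have : k + 1 - σ.card = 1 := by omega
  rw [this, Nat.choose_one_right]
  congr 1
  refine Finset.sum_congr rfl fun τ hτ => ?_
  simp only [ind]
  rw [Finset.sum_boole]
  congr 1
  rw [← Finset.card_image_of_injective (f := fun u : V => ({u} : Finset V)) _
    Finset.singleton_injective]
  congr 1
  ext ρ
  simp only [Finset.mem_filter, Finset.mem_powersetCard, Finset.mem_image, localize,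
    Finset.card_eq_one]
  constructor
  · rintro ⟨⟨h1, u, rfl⟩, a, ⟨h2, h3⟩, h4⟩
    refine ⟨u, ⟨by simpa using h1, ?_⟩, rfl⟩
    have : insert u σ = a := by
      rw [← Finset.sdiff_union_of_subset h3, h4]; rfl
    rwa [this]
  · rintro ⟨u, ⟨h1, h2⟩, rfl⟩
    refine ⟨⟨by simpa using h1, u, rfl⟩, insert u σ, ⟨h2, Finset.subset_insert _ _⟩, ?_⟩
    rw [Finset.mem_sdiff] at h1
    rw [Finset.insert_sdiff_of_notMem _ h1.2]; simp

lemma ind_nonneg (A : Finset (Finset V)) (σ : Finset V) (u : V) : 0 ≤ ind A σ u := by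
  unfold ind; split_ifs <;> norm_num

lemma ind_le_one (A : Finset (Finset V)) (σ : Finset V) (u : V) : ind A σ u ≤ 1 := by
  unfold ind; split_ifs <;> norm_num

lemma EE_le_of_mem (X : Finset (Finset V)) (d k : ℕ) (A : Finset (Finset V)) (σ : Finset V)
    (hXd : IsPureDim X d) (lam : ℝ) (hl : 0 ≤ lam) (hlse : IsLocalSpectralExpander X d lam)
    (hσX : σ ∈ X) (hσ : σ.card = k) (hk : k + 1 ≤ d) :
    EE X (d+1) A σ ≤ (locWt X (d+1) A (k+1) σ + lam) * ((d - k) * LL X (d+1) A σ) := by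
  have hne : (facesCard (link X σ) (d + 1 - σ.card)).Nonempty := by
    obtain ⟨τ, h1, h2, h3⟩ := hXd.2.2 σ hσX
    refine ⟨τ \ σ, ?_⟩
    simp only [facesCard, link, localize, Finset.mem_filter, Finset.mem_image]
    exact ⟨⟨τ, ⟨h1, h2⟩, rfl⟩, by rw [Finset.card_sdiff_of_subset h2, h3]⟩
  have hx := hlse σ hσX (by omega)
  have hx2 : edgeWt (link X σ) (d + 1 - σ.card) = _ := funext fun u => funext fun v => edgeWt_eq _ _ u v
  rw [hx2] at hx
  have := mixing_top (facesCard (link X σ) (d + 1 - σ.card)) (d + 1 - σ.card) (by omega) hne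
    (fun t ht => (Finset.mem_filter.1 ht).2) lam hl _ (by
      apply mul_pos
      · exact_mod_cast hne.card_pos
      · exact_mod_cast Nat.choose_pos (by omega)) hx (ind A σ) (fun u => by
        unfold ind; split_ifs <;> norm_num)
  rw [sum_link _ _ _ _ (by omega), sum_link _ _ _ _ (by omega)] at this
  rw [locWt_eq X (d+1) k A σ hσ (by omega)]
  have e : ((d + 1 - σ.card : ℕ) : ℝ) - 1 = d - k := by
    rw [hσ]; push_cast [Nat.cast_sub (show k ≤ d + 1 by omega)]; ring
  rw [e] at this
  exact this

lemma EE_le (X : Finset (Finset V)) (d k : ℕ) (A : Finset (Finset V)) (σ : Finset V)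
    (hσ : σ.card = k) (hk : k + 1 ≤ d) :
    EE X (d+1) A σ ≤ (d - k) * LL X (d+1) A σ := by
  unfold EE LL
  rw [Finset.mul_sum]
  refine Finset.sum_le_sum fun τ hτ => ?_
  rw [Finset.mul_sum]
  refine Finset.sum_le_sum fun u hu => ?_
  simp only [Finset.mem_filter, facesCard] at hτ
  calc ∑ v ∈ (τ \ σ).erase u, ind A σ u * ind A σ v ≤ ∑ v ∈ (τ \ σ).erase u, ind A σ u :=
        Finset.sum_le_sum fun v _ => mul_le_of_le_one_right (ind_nonneg _ _ _) (ind_le_one _ _ _)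
    _ = (d - k) * ind A σ u := by
        rw [Finset.sum_const, Finset.card_erase_of_mem hu, Finset.card_sdiff_of_subset hτ.2,
          hτ.1.2, hσ, nsmul_eq_mul]
        congr 1
        rw [show d + 1 - k - 1 = d - k by omega, Nat.cast_sub (by omega)]

/-- swapping sum over top faces and k-sets -/
lemma swap (X : Finset (Finset V)) (hX : IsComplex X) (t k : ℕ) (g : Finset V → Finset V → ℝ) :
    ∑ σ ∈ facesCard X k, ∑ τ ∈ (facesCard X t).filter (fun τ => σ ⊆ τ), g σ τ
      = ∑ τ ∈ facesCard X t, ∑ σ ∈ τ.powersetCard k, g σ τ := by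
  apply Finset.sum_comm'
  intro σ τ
  simp only [facesCard, Finset.mem_filter, Finset.mem_powersetCard]
  constructor
  · rintro ⟨⟨a, b⟩, ⟨c, e⟩, f⟩; exact ⟨⟨f, b⟩, c, e⟩
  · rintro ⟨⟨a, b⟩, c, e⟩; exact ⟨⟨hX _ c _ a, b⟩, ⟨c, e⟩, a⟩

noncomputable def MM (X : Finset (Finset V)) (t k : ℕ) (A : Finset (Finset V)) : ℝ :=
  ∑ τ ∈ facesCard X t, ((((τ.powersetCard (k+1)).filter (· ∈ A)).card : ℕ) : ℝ)

lemma sum_LL_S (X : Finset (Finset V)) (hX : IsComplex X) (t k : ℕ) (A S : Finset (Finset V)) :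
    ∑ σ ∈ facesCard X k, (if σ ∈ S then LL X t A σ else 0)
      = ∑ τ ∈ facesCard X t, ∑ a ∈ (τ.powersetCard (k+1)).filter (· ∈ A),
        (((a.powersetCard k).filter (· ∈ S)).card : ℝ) := by
  have : ∀ σ, (if σ ∈ S then LL X t A σ else 0)
      = ∑ τ ∈ (facesCard X t).filter (fun τ => σ ⊆ τ), ∑ u ∈ τ \ σ,
        (if σ ∈ S then 1 else 0) * ind A σ u := by
    intro σ
    unfold LL
    split_ifs <;> simp
  simp only [this]
  rw [swap X hX t k (fun σ τ => ∑ u ∈ τ \ σ, (if σ ∈ S then 1 else 0) * ind A σ u)]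
  refine Finset.sum_congr rfl fun τ _ => ?_
  rw [reindex, Finset.sum_filter]
  refine Finset.sum_congr rfl fun a ha => ?_
  rw [Finset.mem_powersetCard] at ha
  have h1 : ∀ u ∈ a, ind A (a.erase u) u = if a ∈ A then 1 else 0 := by
    intro u hu; unfold ind; rw [Finset.insert_erase hu]
  rw [Finset.sum_congr rfl fun u hu => by rw [h1 u hu]]
  split_ifs with h
  · simp only [mul_one]
    rw [← sum_facets a k ha.2 (fun s => if s ∈ S then (1:ℝ) else 0), Finset.sum_boole]
  · simp

lemma sum_LL (X : Finset (Finset V)) (hX : IsComplex X) (t k : ℕ) (A : Finset (Finset V)) :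
    ∑ σ ∈ facesCard X k, LL X t A σ = (k + 1) * MM X t k A := by
  have := sum_LL_S X hX t k A Finset.univ
  simp only [Finset.mem_univ, if_true, Finset.filter_true] at this
  rw [this, MM, Finset.mul_sum]
  refine Finset.sum_congr rfl fun τ _ => ?_
  rw [Finset.sum_congr rfl (g := fun _ => (k:ℝ)+1)]
  · rw [Finset.sum_const, nsmul_eq_mul, mul_comm]
  · intro a ha
    rw [Finset.mem_filter, Finset.mem_powersetCard] at ha
    rw [Finset.card_powersetCard, ha.1.2]; simp

lemma sum_EE (X : Finset (Finset V)) (hX : IsComplex X) (d k : ℕ) (hk : k + 1 ≤ d)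
    (A : Finset (Finset V))
    (hA : ∀ a ∈ A, ∀ v, v ∉ a → insert v a ∈ X → ∃ u ∈ a, insert v (a.erase u) ∈ A) :
    (d - k) * MM X (d+1) k A ≤ ∑ σ ∈ facesCard X k, EE X (d+1) A σ := by
  unfold EE
  rw [swap X hX (d+1) k (fun σ τ => ∑ u ∈ τ \ σ, ∑ v ∈ (τ \ σ).erase u, ind A σ u * ind A σ v),
    MM, Finset.mul_sum]
  refine Finset.sum_le_sum fun τ hτ => ?_
  simp only [Finset.mem_filter, facesCard] at hτ
  rw [reindex τ k (fun σ u => ∑ v ∈ (τ \ σ).erase u, ind A σ u * ind A σ v)]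
  rw [mul_comm, ← nsmul_eq_mul, ← Finset.sum_const, Finset.sum_filter]
  refine Finset.sum_le_sum fun a ha => ?_
  rw [Finset.mem_powersetCard] at ha
  split_ifs with haA
  · have h1 : ∀ u ∈ a, ∑ v ∈ (τ \ a.erase u).erase u, ind A (a.erase u) u * ind A (a.erase u) v
        = ∑ v ∈ τ \ a, ind A (a.erase u) v := by
      intro u hu
      have : (τ \ a.erase u).erase u = τ \ a := by
        ext x
        simp only [Finset.mem_erase, Finset.mem_sdiff]
        constructor
        · rintro ⟨h1, h2, h3⟩; exact ⟨h2, fun h => h3 ⟨h1, h⟩⟩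
        · rintro ⟨h1, h2⟩
          exact ⟨fun h => h2 (h ▸ hu), h1, fun h => h2 h.2⟩
      rw [this]
      refine Finset.sum_congr rfl fun v _ => ?_
      rw [show ind A (a.erase u) u = 1 by unfold ind; rw [Finset.insert_erase hu, if_pos haA],
        one_mul]
    rw [Finset.sum_congr rfl h1, Finset.sum_comm]
    have h2 : ∀ v ∈ τ \ a, (1:ℝ) ≤ ∑ u ∈ a, ind A (a.erase u) v := by
      intro v hv
      rw [Finset.mem_sdiff] at hv
      obtain ⟨u, hu, hu2⟩ := hA a haA v hv.2 (hX _ hτ.1 _ (Finset.insert_subset hv.1 ha.1))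
      calc (1:ℝ) = ind A (a.erase u) v := by unfold ind; rw [if_pos hu2]
        _ ≤ _ := Finset.single_le_sum (f := fun u => ind A (a.erase u) v)
          (fun _ _ => ind_nonneg _ _ _) hu
    refine le_trans ?_ (Finset.sum_le_sum h2)
    rw [Finset.sum_const, Finset.card_sdiff_of_subset ha.1, hτ.2, ha.2, nsmul_eq_mul, mul_one,
      show d + 1 - (k + 1) = d - k by omega, Nat.cast_sub (by omega)]
  · refine Finset.sum_nonneg fun u _ => Finset.sum_nonneg fun v _ =>
      mul_nonneg (ind_nonneg _ _ _) (ind_nonneg _ _ _)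

lemma MM_zero (X : Finset (Finset V)) (hX : IsComplex X) (d k : ℕ) (hk : k + 1 ≤ d)
    (hXd : IsPureDim X d) (A : Finset (Finset V)) (lam η ε : ℝ) (hl : 0 < lam)
    (hη : 0 < η) (hε : 0 < ε)
    (hlse : IsLocalSpectralExpander X d lam)
    (hsum : lam + η + 2 * ε ≤ 2 / ((d : ℝ) + 1) ^ 2)
    (hA : ∀ a ∈ A, ∀ v, v ∉ a → insert v a ∈ X → ∃ u ∈ a, insert v (a.erase u) ∈ A)
    (hnl : IsNonlocal X (d + 1) k A η ε) : MM X (d+1) k A = 0 := by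
  have hM0 : 0 ≤ MM X (d+1) k A := Finset.sum_nonneg fun _ _ => Nat.cast_nonneg _
  by_contra hMne
  have hM : 0 < MM X (d+1) k A := lt_of_le_of_ne hM0 (Ne.symm hMne)
  set S := nonlocalS X (d+1) k A η with hS
  have hkd : (k:ℝ) + 1 ≤ d := by exact_mod_cast hk
  have hT : (0:ℝ) < (facesCard X (d+1)).card := by
    obtain ⟨x, hx⟩ := hXd.1
    obtain ⟨τ, h1, _, h3⟩ := hXd.2.2 x hx
    exact_mod_cast Finset.card_pos.2 ⟨τ, Finset.mem_filter.2 ⟨h1, h3⟩⟩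
  have hLS : (1 - ε) * ((k + 1) * MM X (d+1) k A)
      ≤ ∑ σ ∈ facesCard X k, (if σ ∈ S then LL X (d+1) A σ else 0) := by
    rw [sum_LL_S X hX]
    unfold IsNonlocal mwt wt at hnl
    rw [← hS] at hnl
    have hch : (0:ℝ) < ((d+1).choose (k+1) : ℕ) := by
      exact_mod_cast Nat.choose_pos (by omega)
    rw [ge_iff_le, Nat.choose_succ_self_right, le_div_iff₀ (by positivity)] at hnl
    refine le_trans (le_of_eq ?_) hnl
    unfold MM
    rw [Nat.cast_add_one]
    have aux : ∀ M N C e q : ℝ, 0 < N → 0 < C →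
        (1 - e) * (q * M) = (1 - e) * (M / (N * C)) * (N * C * q) := by
      intro M N C e q h1 h2
      have h3 : N * C ≠ 0 := (mul_pos h1 h2).ne'
      calc (1 - e) * (q * M) = (1 - e) * q * M := by ring
        _ = (1 - e) * q * (M / (N * C) * (N * C)) := by rw [div_mul_cancel₀ _ h3]
        _ = _ := by ring
    exact aux _ _ _ _ _ hT hch
  have hL := sum_LL X hX (d+1) k A
  have hE := sum_EE X hX d k hk A hA
  have hLnn : ∀ σ, 0 ≤ LL X (d+1) A σ := fun σ =>
    Finset.sum_nonneg fun _ _ => Finset.sum_nonneg fun _ _ => ind_nonneg _ _ _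
  have hdk : (0:ℝ) < d - k := by linarith
  have hup : ∑ σ ∈ facesCard X k, EE X (d+1) A σ ≤ ∑ σ ∈ facesCard X k,
      (d - k) * ((η + lam) * LL X (d+1) A σ +
        (LL X (d+1) A σ - if σ ∈ S then LL X (d+1) A σ else 0)) := by
    refine Finset.sum_le_sum fun σ hσ => ?_
    have hσ' := Finset.mem_filter.1 hσ
    have h0 := mul_nonneg hdk.le (hLnn σ)
    split_ifs with hσS
    · have h1 := EE_le_of_mem X d k A σ hXd lam hl.le hlse hσ'.1 hσ'.2 hk
      have h2 := (Finset.mem_filter.1 hσS).2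
      have h3 := mul_le_mul_of_nonneg_right h2 h0
      linarith
    · have h1 := EE_le X d k A σ hσ'.2 hk
      have := mul_nonneg (add_pos hη hl).le h0
      linarith
  rw [← Finset.mul_sum, Finset.sum_add_distrib, Finset.sum_sub_distrib, ← Finset.mul_sum, hL] at hup
  have h1 := le_of_mul_le_mul_left (hE.trans hup) hdk
  have h2 : MM X (d+1) k A * 1 ≤ MM X (d+1) k A * ((k+1) * (η + lam + ε)) := by
    linarith
  have h3 := le_of_mul_le_mul_left h2 hM
  have hd1 : (0:ℝ) < ((d:ℝ)+1)^2 := by positivity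
  rw [le_div_iff₀ hd1] at hsum
  have h4 : (1:ℝ) ≤ d * (lam + η + 2 * ε) := by
    have : ((k:ℝ)+1) * (η + lam + ε) ≤ d * (lam + η + 2 * ε) := by
      apply mul_le_mul hkd <;> linarith
    linarith
  have h5 : ((d:ℝ)+1)^2 ≤ d * 2 := by
    have hd : (0:ℝ) ≤ d := by positivity
    calc ((d:ℝ)+1)^2 = 1 * ((d:ℝ)+1)^2 := by ring
      _ ≤ (d * (lam + η + 2 * ε)) * ((d:ℝ)+1)^2 := mul_le_mul_of_nonneg_right h4 hd1.le
      _ = d * ((lam + η + 2 * ε) * ((d:ℝ)+1)^2) := by ring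
      _ ≤ d * 2 := mul_le_mul_of_nonneg_left hsum hd
  nlinarith [sq_nonneg (d:ℝ)]

end HDXP


/-- Non-local cocycles vanish: for `λ + η + 2ε ≤ 2/(d+1)²`, in a
`d`-dimensional `λ`-local spectral expander, any cocycle `f ∈ Z^k(X;G)` (`0 ≤ k ≤ d-1`)
whose support is `(η,ε)`-non-local is zero. -/
theorem stmt1 {V : Type*} [Fintype V] [DecidableEq V] {G : Type*} [AddCommGroup G]
    (d : ℕ) (lam η ε : ℝ)
    (hlam0 : 0 < lam) (hlam1 : lam < 1) (hη0 : 0 < η) (hη1 : η < 1)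
    (hε0 : 0 < ε) (hε1 : ε < 1)
    (hsum : lam + η + 2 * ε ≤ 2 / ((d : ℝ) + 1) ^ 2)
    (X : Finset (Finset V)) (hX : HDX.IsComplex X) (hXd : HDX.IsPureDim X d)
    (hlse : HDX.IsLocalSpectralExpander X d lam)
    (k : ℕ) (hk : k + 1 ≤ d)
    (f : (Fin (k + 1) → V) → G) (hf : HDX.IsCocycle X f)
    (hnl : HDX.IsNonlocal X (d + 1) k (HDX.suppC X f) η ε) :
    f = 0 := by
  by_contra hne
  have hM := HDXP.MM_zero X hX d k hk hXd (HDX.suppC X f) lam η ε hlam0 hη0 hε0 hlse hsum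
    (fun a ha v hv hva => HDXP.cocycle_step X hX k f hf a ha v hv hva) hnl
  apply hne
  funext tup
  by_contra htup
  have hft : HDX.IsFaceTup X tup := by
    by_contra h
    exact htup (hf.1.2 _ h)
  obtain ⟨τ, h1, h2, h3⟩ := hXd.2.2 _ hft.2
  have hcard : (Finset.image tup Finset.univ).card = k + 1 := by
    rw [Finset.card_image_of_injective _ hft.1]; simp
  have h4 := (Finset.sum_eq_zero_iff_of_nonneg (fun _ _ => Nat.cast_nonneg _)).1 hM τ
    (Finset.mem_filter.2 ⟨h1, h3⟩)
  have h5 := Finset.card_eq_zero.1 (Nat.cast_eq_zero.1 h4)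
  have h6 : Finset.image tup Finset.univ ∈
      (τ.powersetCard (k+1)).filter (· ∈ HDX.suppC X f) := by
    rw [Finset.mem_filter, Finset.mem_powersetCard]
    exact ⟨⟨h2, hcard⟩, Finset.mem_filter.2 ⟨Finset.mem_filter.2 ⟨hft.2, hcard⟩, tup, rfl, htup⟩⟩
  rw [h5] at h6
  exact Finset.notMem_empty _ h6
end
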